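/- arXiv:2407.09213 — 3 statements merged into one kernel-verified Lean document; each statement's English description precedes it below -/
import Mathlib

section
/- If p : ℝ^n → ℝ is a complete isometric hyperbolic polynomial of degree d along e, then for every u ∈ λ(ℝ^n) and every x ∈ ℝ^n, the Euclidean distance ‖u − λ(x)‖_2 in ℝ^d equals the distance dist_p(λ^{-1}(u), x) = inf{‖y − x‖_p : y ∈ ℝ^n, λ(y) = u} measured in the norm ‖·‖_p on ℝ^n. -/
noncomputable def hypLine {n : ℕ} {K : Type*} [Field K] [Algebra ℝ K] (R : MvPolynomial (Fin n) ℝ)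
    (v w : Fin n → K) : Polynomial K :=
  MvPolynomial.aeval (fun j => Polynomial.C (v j) + Polynomial.X * Polynomial.C (w j)) R

lemma hypLine_eval {n : ℕ} {K : Type*} [Field K] [Algebra ℝ K] (R : MvPolynomial (Fin n) ℝ)
    (v w : Fin n → K) (t : K) :
    (hypLine R v w).eval t = MvPolynomial.aeval (v + t • w) R := by
  have : ((Polynomial.aeval (R := K) t).restrictScalars ℝ) (hypLine R v w)
      = MvPolynomial.aeval (v + t • w) R := by
    rw [hypLine, MvPolynomial.comp_aeval_apply]
    congr 2
    funext j
    simp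
    ring
  simpa [Polynomial.coe_aeval_eq_eval] using this

lemma hypLine_aux {K : Type*} [Field K] {σ : Type*} (s : Finset σ) (d : σ → ℕ) (v w : σ → K) :
    (∏ i ∈ s, (Polynomial.C (v i) + Polynomial.X * Polynomial.C (w i)) ^ d i).natDegree
        ≤ ∑ i ∈ s, d i ∧
    (∏ i ∈ s, (Polynomial.C (v i) + Polynomial.X * Polynomial.C (w i)) ^ d i).coeff (∑ i ∈ s, d i)
      = ∏ i ∈ s, w i ^ d i := by
  classical
  have h1 : ∀ i, (Polynomial.C (v i) + Polynomial.X * Polynomial.C (w i)).natDegree ≤ 1 := by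
    intro i
    compute_degree
  induction s using Finset.induction_on with
  | empty => simp
  | insert a s ha ih =>
    have h2 : ((Polynomial.C (v a) + Polynomial.X * Polynomial.C (w a)) ^ d a).natDegree ≤ d a := by
      have := Polynomial.natDegree_pow_le_of_le (d a) (h1 a)
      simpa using this
    have h3 : ((Polynomial.C (v a) + Polynomial.X * Polynomial.C (w a)) ^ d a).coeff (d a)
        = w a ^ d a := by
      have := Polynomial.coeff_pow_of_natDegree_le (m := d a) (h1 a)
      simpa [Polynomial.coeff_C] using this
    rw [Finset.prod_insert ha, Finset.sum_insert ha, Finset.prod_insert ha]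
    refine ⟨Polynomial.natDegree_mul_le_of_le h2 ih.1, ?_⟩
    rw [Polynomial.coeff_mul_add_eq_of_natDegree_le h2 ih.1, h3, ih.2]

lemma hypLine_deg {n N : ℕ} {K : Type*} [Field K] [Algebra ℝ K] {R : MvPolynomial (Fin n) ℝ}
    (hR : R.IsHomogeneous N) (v w : Fin n → K) :
    (hypLine R v w).natDegree ≤ N ∧ (hypLine R v w).coeff N = MvPolynomial.aeval w R := by
  have hd : ∀ m ∈ R.support, ∑ i, m i = N := by
    intro m hm
    have := hR.degree_eq_sum_deg_support hm
    rw [this, ← Finsupp.degree_eq_sum]; rfl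
  rw [hypLine, MvPolynomial.aeval_def, MvPolynomial.aeval_def, MvPolynomial.eval₂_eq',
    MvPolynomial.eval₂_eq']
  constructor
  · refine Polynomial.natDegree_sum_le_of_forall_le _ _ ?_
    intro m hm
    rw [Polynomial.algebraMap_apply]
    refine (Polynomial.natDegree_C_mul_le _ _).trans ?_
    rw [← hd m hm]
    exact (hypLine_aux _ _ _ _).1
  · rw [Polynomial.finsetSum_coeff]
    refine Finset.sum_congr rfl ?_
    intro m hm
    rw [Polynomial.algebraMap_apply, Polynomial.coeff_C_mul]
    congr 1
    have := (hypLine_aux Finset.univ m v w).2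
    rwa [hd m hm] at this

lemma hypLine_cont {n : ℕ} {T : Type*} [TopologicalSpace T] (R : MvPolynomial (Fin n) ℝ)
    (v : T → Fin n → ℂ) (hv : Continuous v) (w : Fin n → ℂ) (k : ℕ) :
    Continuous (fun τ => (hypLine R (v τ) w).coeff k) := by
  unfold hypLine
  induction R using MvPolynomial.induction_on generalizing k with
  | C a =>
    simp only [MvPolynomial.algHom_C]
    exact continuous_const
  | add p q hp hq =>
    simp only [map_add, Polynomial.coeff_add]
    exact (hp k).add (hq k)
  | mul_X p j hp =>
    have hvj : Continuous fun τ => v τ j := (continuous_apply j).comp hv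
    simp only [map_mul, MvPolynomial.aeval_X, mul_add, Polynomial.coeff_add, Polynomial.coeff_mul_C,
      ← mul_assoc]
    refine ((hp k).mul hvj).add (Continuous.mul ?_ continuous_const)
    cases k with
    | zero => simpa using continuous_const
    | succ k => simpa using hp k

lemma hyp_hom_smul {n N : ℕ} {K : Type*} [Field K] [Algebra ℝ K] {R : MvPolynomial (Fin n) ℝ}
    (hR : R.IsHomogeneous N) (c : K) (w : Fin n → K) :
    MvPolynomial.aeval (c • w) R = c ^ N * MvPolynomial.aeval w R := by
  rw [MvPolynomial.aeval_def, MvPolynomial.aeval_def, MvPolynomial.eval₂_eq',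
    MvPolynomial.eval₂_eq', Finset.mul_sum]
  refine Finset.sum_congr rfl ?_
  intro m hm
  have hd : ∑ i, m i = N := by
    rw [hR.degree_eq_sum_deg_support hm, ← Finsupp.degree_eq_sum]; rfl
  simp only [Pi.smul_apply, smul_eq_mul, mul_pow, Finset.prod_mul_distrib, Finset.prod_pow_eq_pow_sum, hd]
  ring

/-- homotopy lemma -/
lemma hyp_homotopy (N : ℕ) (L : ℂ) (hL : L ≠ 0) (F : unitInterval → Polynomial ℂ)
    (hdeg : ∀ τ, (F τ).natDegree ≤ N) (hlead : ∀ τ, (F τ).coeff N = L)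
    (hcont : ∀ k, Continuous fun τ => (F τ).coeff k)
    (hreal : ∀ τ, ∀ t : ℝ, (F τ).eval (t : ℂ) ≠ 0)
    (h0 : ∀ t : ℂ, 0 ≤ t.im → (F 0).eval t ≠ 0) :
    ∀ τ, ∀ t : ℂ, 0 ≤ t.im → (F τ).eval t ≠ 0 := by
  have hnd : ∀ τ, (F τ).natDegree = N := fun τ =>
    le_antisymm (hdeg τ) (Polynomial.le_natDegree_of_ne_zero (by rw [hlead]; exact hL))
  have hlc : ∀ τ, (F τ).leadingCoeff = L := fun τ => by
    rw [Polynomial.leadingCoeff, hnd, hlead]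
  have hne : ∀ τ, F τ ≠ 0 := fun τ h => by
    have := hlead τ
    rw [h] at this
    exact hL (by simpa using this.symm)
  have hjoint : Continuous fun q : unitInterval × ℂ => (F q.1).eval q.2 := by
    have : (fun q : unitInterval × ℂ => (F q.1).eval q.2)
        = fun q => ∑ k ∈ Finset.range (N + 1), (F q.1).coeff k * q.2 ^ k := by
      funext q
      rw [Polynomial.eval_eq_sum_range, hnd]
    rw [this]
    refine continuous_finsetSum _ fun k _ => ?_
    exact ((hcont k).comp continuous_fst).mul (continuous_snd.pow k)
  -- bound on roots
  obtain ⟨B, hB⟩ : ∃ B : ℝ, ∀ τ, ∀ t : ℂ, (F τ).eval t = 0 → ‖t‖ ≤ B := by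
    have hb : ∀ k, ∃ b : NNReal, ∀ τ, ‖(F τ).coeff k‖₊ ≤ b := by
      intro k
      obtain ⟨τ0, -, h⟩ := isCompact_univ.exists_isMaxOn (Set.univ_nonempty (α := unitInterval))
        ((hcont k).nnnorm.continuousOn)
      exact ⟨_, fun τ => h (Set.mem_univ τ)⟩
    choose b hb using hb
    refine ⟨(((Finset.range N).sup b / ‖L‖₊ + 1 : NNReal) : ℝ), fun τ t ht => ?_⟩
    have h1 := Polynomial.IsRoot.norm_lt_cauchyBound (hne τ) (a := t) ht
    refine (show ‖t‖ ≤ ((F τ).cauchyBound : ℝ) from le_of_lt (by exact_mod_cast h1)).trans ?_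
    rw [NNReal.coe_le_coe, Polynomial.cauchyBound, hnd, hlc]
    gcongr
    exact hb _ _
  set Bad : Set unitInterval := {τ | ∃ t : ℂ, 0 ≤ t.im ∧ (F τ).eval t = 0} with hBad
  have hclosed : IsClosed Bad := by
    have : Bad = Prod.fst '' ({q : unitInterval × ℂ | q.2 ∈ Metric.closedBall (0:ℂ) B} ∩
        {q | 0 ≤ q.2.im ∧ (F q.1).eval q.2 = 0}) := by
      ext τ
      constructor
      · rintro ⟨t, h1, h2⟩
        exact ⟨(τ, t), ⟨by simpa using hB τ t h2, h1, h2⟩, rfl⟩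
      · rintro ⟨⟨τ', t⟩, ⟨-, h1, h2⟩, rfl⟩
        exact ⟨t, h1, h2⟩
    rw [this]
    refine (IsCompact.image ?_ continuous_fst).isClosed
    refine IsCompact.inter_right ?_ ?_
    · have h := (isCompact_univ (X := unitInterval)).prod (isCompact_closedBall (0:ℂ) B)
      convert h using 1
      ext q
      simp
    · exact (isClosed_le continuous_const (Complex.continuous_im.comp continuous_snd)).inter
        (isClosed_eq hjoint continuous_const)
  have hopen : IsOpen Bad := by
    rw [isOpen_iff_mem_nhds]
    rintro τ ⟨t, h1, h2⟩
    have hpos : 0 < t.im := by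
      rcases h1.lt_or_eq with h | h
      · exact h
      · exfalso
        refine hreal τ t.re ?_
        rwa [show ((t.re : ℝ) : ℂ) = t from Complex.ext (by simp) (by simpa using h)]
    have hc : Continuous fun τ' => ‖(F τ').eval t‖ :=
      (hjoint.comp (continuous_id.prodMk continuous_const)).norm
    have hlt : ‖(F τ).eval t‖ < ‖L‖ * t.im ^ N := by
      rw [h2, norm_zero]
      have := norm_pos_iff.2 hL
      positivity
    filter_upwards [(hc.tendsto τ).eventually (gt_mem_nhds hlt)] with τ' hτ'
    by_contra hgood
    refine absurd hτ' (not_lt.2 ?_)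
    have hs : (F τ').Splits := IsAlgClosed.splits _
    have he : (F τ').eval t = L * ((F τ').roots.map fun a => t - a).prod := by
      conv_lhs => rw [hs.eq_prod_roots]
      rw [hlc]
      simp [Polynomial.eval_multiset_prod]
    have hcard : Multiset.card (F τ').roots = N := by
      rw [← hs.natDegree_eq_card_roots, hnd]
    rw [he, norm_mul]
    gcongr
    have hroot : ∀ a ∈ (F τ').roots, t.im ≤ ‖t - a‖ := by
      intro a ha
      have : a.im < 0 := by
        by_contra h
        exact hgood ⟨a, not_lt.1 h, Polynomial.isRoot_of_mem_roots ha⟩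
      have h3 := (le_abs_self _).trans (Complex.abs_im_le_norm (t - a))
      rw [Complex.sub_im] at h3
      linarith
    rw [← hcard]
    generalize (F τ').roots = S at hroot
    induction S using Multiset.induction_on with
    | empty => simp
    | cons a S ih =>
      have h4 := hroot a (Multiset.mem_cons_self a S)
      have h5 := ih fun b hb => hroot b (Multiset.mem_cons_of_mem hb)
      rw [Multiset.card_cons, Multiset.map_cons, Multiset.prod_cons, norm_mul, pow_succ']
      gcongr
  intro τ t ht hev
  rcases isClopen_iff.1 (⟨hclosed, hopen⟩ : IsClopen Bad) with h | h
  · have : τ ∈ Bad := ⟨t, ht, hev⟩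
    rw [h] at this
    exact this
  · have : (0 : unitInterval) ∈ Bad := by rw [h]; trivial
    obtain ⟨t, h1, h2⟩ := this
    exact h0 t h1 h2

def hypCx {n : ℕ} (v : Fin n → ℝ) : Fin n → ℂ := fun j => (v j : ℂ)

lemma hypCx_aeval {n : ℕ} (R : MvPolynomial (Fin n) ℝ) (v : Fin n → ℝ) :
    MvPolynomial.aeval (hypCx v) R = ((MvPolynomial.eval v R : ℝ) : ℂ) := by
  have := MvPolynomial.aeval_algebraMap_apply ℂ v R
  rw [MvPolynomial.aeval_eq_eval] at this
  exact this

lemma hyp_cplx {n : ℕ} {ι : Type*} [Fintype ι] (R : MvPolynomial (Fin n) ℝ) (e z : Fin n → ℝ)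
    (μ : ι → ℝ) (h : ∀ s : ℝ, MvPolynomial.eval (z + s • e) R = ∏ i, (μ i + s)) :
    hypLine R (hypCx z) (hypCx e) = ∏ i, (Polynomial.X + Polynomial.C (μ i : ℂ)) := by
  refine Polynomial.eq_of_infinite_eval_eq _ _ ?_
  refine (Set.infinite_range_of_injective Complex.ofReal_injective).mono ?_
  rintro _ ⟨s, rfl⟩
  simp only [Set.mem_ofPred_eq]
  rw [hypLine_eval]
  have : hypCx z + (s : ℂ) • hypCx e = hypCx (z + s • e) := by
    funext j
    simp [hypCx]
  rw [this, hypCx_aeval, h, Polynomial.eval_prod]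
  push_cast
  refine Finset.prod_congr rfl fun i _ => ?_
  simp [add_comm]

lemma hyp_cplx_eval {n : ℕ} {ι : Type*} [Fintype ι] (R : MvPolynomial (Fin n) ℝ) (e z : Fin n → ℝ)
    (μ : ι → ℝ) (h : ∀ s : ℝ, MvPolynomial.eval (z + s • e) R = ∏ i, (μ i + s)) (s : ℂ) :
    MvPolynomial.aeval (hypCx z + s • hypCx e) R = ∏ i, ((μ i : ℂ) + s) := by
  rw [← hypLine_eval, hyp_cplx R e z μ h, Polynomial.eval_prod]
  refine Finset.prod_congr rfl fun i _ => ?_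
  simp [add_comm]

lemma hyp_e {n : ℕ} {ι : Type*} [Fintype ι] (R : MvPolynomial (Fin n) ℝ)
    (hR : R.IsHomogeneous (Fintype.card ι)) (e z : Fin n → ℝ)
    (μ : ι → ℝ) (h : ∀ s : ℝ, MvPolynomial.eval (z + s • e) R = ∏ i, (μ i + s)) :
    MvPolynomial.aeval (hypCx e) R = 1 := by
  rw [← (hypLine_deg hR (hypCx z) (hypCx e)).2, hyp_cplx R e z μ h]
  have hm : (∏ i, (Polynomial.X + Polynomial.C (μ i : ℂ))).Monic :=
    Polynomial.monic_prod_of_monic _ _ fun i _ => Polynomial.monic_X_add_C _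
  have hd : (∏ i, (Polynomial.X + Polynomial.C (μ i : ℂ))).natDegree = Fintype.card ι := by
    rw [Polynomial.natDegree_prod_of_monic _ _ fun i _ => Polynomial.monic_X_add_C _]
    simp
  rw [← hd]
  exact hm

lemma hyp_cone {n : ℕ} {ι : Type*} [Fintype ι] (R : MvPolynomial (Fin n) ℝ)
    (hR : R.IsHomogeneous (Fintype.card ι)) (e z : Fin n → ℝ)
    (μ : ι → ℝ) (h : ∀ s : ℝ, MvPolynomial.eval (z + s • e) R = ∏ i, (μ i + s))
    (hμ : ∀ i, 0 < μ i) (t c : ℂ) (ht : 0 ≤ t.im) (hc : 0 < c.im) :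
    MvPolynomial.aeval (c • hypCx e + t • hypCx z) R ≠ 0 := by
  have hc0 : c ≠ 0 := by rintro rfl; simp at hc
  by_cases ht0 : t = 0
  · rw [ht0, zero_smul, add_zero, hyp_hom_smul hR, hyp_e R hR e z μ h, mul_one]
    exact pow_ne_zero _ hc0
  · have : c • hypCx e + t • hypCx z = t • (hypCx z + (c / t) • hypCx e) := by
      rw [smul_add, smul_smul, mul_div_cancel₀ _ ht0, add_comm]
    rw [this, hyp_hom_smul hR, hyp_cplx_eval R e z μ h]
    refine mul_ne_zero (pow_ne_zero _ ht0) (Finset.prod_ne_zero_iff.2 fun i _ h0 => ?_)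
    have h1 : (μ i : ℂ) * t + c = 0 := by
      have : ((μ i : ℂ) + c / t) * t = 0 := by rw [h0, zero_mul]
      rwa [add_mul, div_mul_cancel₀ _ ht0] at this
    have h2 := congrArg Complex.im h1
    simp at h2
    have := mul_nonneg (hμ i).le ht
    linarith

lemma hyp_step {n N : ℕ} (R : MvPolynomial (Fin n) ℝ)
    (hR : R.IsHomogeneous N) (v w y : Fin n → ℂ) (hy : MvPolynomial.aeval y R ≠ 0)
    (hreal : ∀ τ : unitInterval, ∀ t : ℝ,
      MvPolynomial.aeval (v + ((τ : ℝ) : ℂ) • w + (t : ℂ) • y) R ≠ 0)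
    (h0 : ∀ t : ℂ, 0 ≤ t.im → MvPolynomial.aeval (v + t • y) R ≠ 0)
    (t : ℂ) (ht : 0 ≤ t.im) : MvPolynomial.aeval (v + w + t • y) R ≠ 0 := by
  have := hyp_homotopy N _ hy (fun τ : unitInterval => hypLine R (v + ((τ : ℝ) : ℂ) • w) y)
    (fun τ => (hypLine_deg hR _ _).1) (fun τ => (hypLine_deg hR _ _).2)
    (fun k => hypLine_cont R _ (by fun_prop) _ _)
    (fun τ t => by rw [hypLine_eval]; exact hreal τ t)
    (fun t ht => by rw [hypLine_eval]; simpa using h0 t ht) 1 t ht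
  rw [hypLine_eval] at this
  simpa using this

lemma hyp_garding {n : ℕ} {ι : Type*} [Fintype ι] (R : MvPolynomial (Fin n) ℝ)
    (hR : R.IsHomogeneous (Fintype.card ι)) (e : Fin n → ℝ)
    (hyp : ∀ z, ∃ μ : ι → ℝ, ∀ s : ℝ, MvPolynomial.eval (z + s • e) R = ∏ i, (μ i + s))
    (x y : Fin n → ℝ) (ν κ : ι → ℝ) (hν0 : ∀ i, 0 < ν i) (hκ0 : ∀ i, 0 < κ i)
    (hν : ∀ s : ℝ, MvPolynomial.eval (x + s • e) R = ∏ i, (ν i + s))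
    (hκ : ∀ s : ℝ, MvPolynomial.eval (y + s • e) R = ∏ i, (κ i + s))
    (ε : ℝ) (hε : 0 < ε) : MvPolynomial.eval (x + y + ε • e) R ≠ 0 := by
  have hnz : ∀ (z : Fin n → ℝ) (μ : ι → ℝ) (_ : ∀ i, 0 < μ i)
      (_ : ∀ s : ℝ, MvPolynomial.eval (z + s • e) R = ∏ i, (μ i + s)),
      MvPolynomial.aeval (hypCx z) R ≠ 0 := by
    intro z μ hμ h
    have := hyp_cplx_eval R e z μ h 0
    rw [zero_smul, add_zero] at this
    rw [this]
    refine Finset.prod_ne_zero_iff.2 fun i _ => ?_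
    rw [add_zero]
    exact_mod_cast (hμ i).ne'
  have hreal : ∀ (z : Fin n → ℝ) (c : ℂ), 0 < c.im →
      MvPolynomial.aeval (hypCx z + c • hypCx e) R ≠ 0 := by
    intro z c hc
    obtain ⟨μ, h⟩ := hyp z
    rw [hyp_cplx_eval R e z μ h]
    refine Finset.prod_ne_zero_iff.2 fun i _ h0 => ?_
    have := congrArg Complex.im h0
    simp at this
    linarith
  have step1 : ∀ (z : Fin n → ℝ) (b c : ℂ), 0 ≤ b.im → 0 < c.im →
      MvPolynomial.aeval (c • hypCx e + hypCx z + b • hypCx y) R ≠ 0 := by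
    intro z b c hb hc
    refine hyp_step R hR _ _ _ (hnz y κ hκ0 hκ) ?_ ?_ b hb
    · intro τ t
      have := hreal ((τ : ℝ) • z + t • y) c hc
      convert this using 3
      funext j
      simp [hypCx]
      ring
    · intro t ht
      exact hyp_cone R hR e y κ hκ hκ0 t c ht hc
  have step2 : ∀ (a b c : ℂ), 0 ≤ a.im → 0 ≤ b.im → 0 < c.im →
      MvPolynomial.aeval (c • hypCx e + b • hypCx y + a • hypCx x) R ≠ 0 := by
    intro a b c ha hb hc
    refine hyp_step R hR _ _ _ (hnz x ν hν0 hν) ?_ ?_ a ha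
    · intro τ t
      have := step1 (t • x) ((τ : ℝ) * b) c (by
        rw [Complex.im_ofReal_mul]; exact mul_nonneg τ.2.1 hb) hc
      convert this using 3
      funext j
      simp [hypCx]
      ring
    · intro t ht
      exact hyp_cone R hR e x ν hν hν0 t c ht hc
  have := step2 Complex.I Complex.I (ε * Complex.I) (by simp) (by simp) (by simpa using hε)
  intro h0
  refine this ?_
  have h1 : ((ε : ℂ) * Complex.I) • hypCx e + Complex.I • hypCx y + Complex.I • hypCx x
      = Complex.I • hypCx (x + y + ε • e) := by
    funext j
    simp [hypCx]
    ring
  rw [h1, hyp_hom_smul hR, hypCx_aeval, h0]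
  simp

lemma hyp_subadd {n : ℕ} {ι : Type*} [Fintype ι] (R : MvPolynomial (Fin n) ℝ)
    (hR : R.IsHomogeneous (Fintype.card ι)) (e : Fin n → ℝ) (μ : (Fin n → ℝ) → ι → ℝ)
    (hyp : ∀ z (t : ℝ), MvPolynomial.eval (z - t • e) R = ∏ i, (μ z i - t))
    (x y : Fin n → ℝ) (A B : ℝ) (hA : ∀ i, μ x i ≤ A) (hB : ∀ i, μ y i ≤ B) (j : ι) :
    μ (x + y) j ≤ A + B := by
  by_contra hlt
  push Not at hlt
  set m := μ (x + y) j with hm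
  set δ := (m - A - B) / 3 with hδ
  have hδ0 : 0 < δ := by rw [hδ]; linarith
  have hneg : ∀ z : Fin n → ℝ, MvPolynomial.eval (-z) R
      = (-1) ^ Fintype.card ι * MvPolynomial.eval z R := by
    intro z
    have := hyp_hom_smul hR (-1 : ℝ) z
    rw [MvPolynomial.aeval_eq_eval] at this
    simpa using this
  have hrefl : ∀ (z : Fin n → ℝ) (a s : ℝ), MvPolynomial.eval ((a • e - z) + s • e) R
      = ∏ i, ((a - μ z i) + s) := by
    intro z a s
    have : (a • e - z) + s • e = -(z - (a + s) • e) := by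
      rw [add_smul]; abel
    rw [this, hneg, hyp, ← Finset.card_univ, ← Finset.prod_const, ← Finset.prod_mul_distrib]
    refine Finset.prod_congr rfl fun i _ => ?_
    ring
  refine hyp_garding R hR e ?_ ((A + δ) • e - x) ((B + δ) • e - y) _ _ ?_ ?_
    (hrefl x (A + δ)) (hrefl y (B + δ)) δ hδ0 ?_
  · intro z
    refine ⟨μ z, fun s => ?_⟩
    have := hyp z (-s)
    simpa using this
  · intro i
    have := hA i
    linarith
  · intro i
    have := hB i
    linarith
  · have h1 : (A + δ) • e - x + ((B + δ) • e - y) + δ • e = (m • e - (x + y)) + (0:ℝ) • e := by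
      have : m = (A + δ) + (B + δ) + δ := by rw [hδ]; ring
      rw [this]
      module
    rw [h1, hrefl]
    exact Finset.prod_eq_zero (Finset.mem_univ j) (by simp [hm])

lemma hyp_prod_eq {d : ℕ} (a b : Fin d → ℝ) (h : ∀ t : ℝ, ∏ i, (a i - t) = ∏ i, (b i - t))
    (S : MvPolynomial (Fin d) ℝ) (hS : S.IsSymmetric) :
    MvPolynomial.eval a S = MvPolynomial.eval b S := by
  obtain ⟨F, hF⟩ := MvPolynomial.esymmAlgHom_fin_surjective ℝ (le_refl d) ⟨S, hS⟩
  have hF' : S = MvPolynomial.aeval (fun i : Fin d => MvPolynomial.esymm (Fin d) ℝ (i + 1)) F := by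
    have := congrArg Subtype.val hF
    rw [MvPolynomial.esymmAlgHom_apply] at this
    exact this.symm
  have hp : ∏ i, (Polynomial.X + Polynomial.C (a i)) = ∏ i, (Polynomial.X + Polynomial.C (b i)) := by
    refine Polynomial.funext fun s => ?_
    have := h (-s)
    simp only [sub_neg_eq_add] at this
    simpa [Polynomial.eval_prod, add_comm] using this
  have he : ∀ k, k ≤ d → MvPolynomial.eval a (MvPolynomial.esymm (Fin d) ℝ k)
      = MvPolynomial.eval b (MvPolynomial.esymm (Fin d) ℝ k) := by
    intro k hk
    have h1 := congrArg (fun q => Polynomial.coeff q (d - k)) hp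
    rw [Finset.prod_X_add_C_coeff _ _ (by simp), Finset.prod_X_add_C_coeff _ _ (by simp)] at h1
    simpa [MvPolynomial.esymm, Nat.sub_sub_self hk] using h1
  have key : ∀ c : Fin d → ℝ, MvPolynomial.eval c S = MvPolynomial.eval
      (fun i : Fin d => MvPolynomial.eval c (MvPolynomial.esymm (Fin d) ℝ (i + 1))) F := by
    intro c
    rw [hF', ← MvPolynomial.aeval_eq_eval, MvPolynomial.comp_aeval_apply,
      MvPolynomial.aeval_eq_eval, MvPolynomial.aeval_eq_eval]
  rw [key, key]
  congr 2
  funext i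
  exact he _ i.2

lemma hyp_sym_poly {n d : ℕ} (P : MvPolynomial (Fin n) ℝ) (e : Fin n → ℝ)
    (lm : (Fin n → ℝ) → Fin d → ℝ)
    (hpe : MvPolynomial.eval e P ≠ 0)
    (hroots : ∀ (x : Fin n → ℝ) (t : ℝ),
      MvPolynomial.eval (x - t • e) P = MvPolynomial.eval e P * ∏ i, (lm x i - t))
    (S : MvPolynomial (Fin d) ℝ) (hS : S.IsSymmetric) :
    ∃ R : MvPolynomial (Fin n) ℝ, ∀ x, MvPolynomial.eval x R = MvPolynomial.eval (lm x) S := by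
  obtain ⟨F, hF⟩ := MvPolynomial.esymmAlgHom_fin_surjective ℝ (le_refl d) ⟨S, hS⟩
  have hF' : S = MvPolynomial.aeval (fun i : Fin d => MvPolynomial.esymm (Fin d) ℝ (i + 1)) F := by
    have := congrArg Subtype.val hF
    rw [MvPolynomial.esymmAlgHom_apply] at this
    exact this.symm
  let W : Polynomial (MvPolynomial (Fin n) ℝ) := MvPolynomial.aeval
    (fun j => Polynomial.C (MvPolynomial.X j) + Polynomial.X * Polynomial.C (MvPolynomial.C (e j))) P
  have hW : ∀ x, W.map (MvPolynomial.eval x) = hypLine P x e := by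
    intro x
    have : (Polynomial.mapAlgHom (MvPolynomial.aeval (R := ℝ) x)) W = hypLine P x e := by
      simp only [W]
      rw [hypLine, MvPolynomial.comp_aeval_apply]
      congr 2
      funext j
      simp
    rw [← this]
    rw [Polynomial.coe_mapAlgHom]
    congr 1
  have hL : ∀ x, hypLine P x e
      = Polynomial.C (MvPolynomial.eval e P) * ∏ i, (Polynomial.X + Polynomial.C (lm x i)) := by
    intro x
    refine Polynomial.funext fun s => ?_
    rw [hypLine_eval, MvPolynomial.aeval_eq_eval]
    have := hroots x (-s)
    simp only [sub_neg_eq_add, neg_smul] at this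
    simp [this, Polynomial.eval_prod, add_comm]
  have he : ∀ x k, k ≤ d → MvPolynomial.eval x (W.coeff (d - k))
      = MvPolynomial.eval e P * MvPolynomial.eval (lm x) (MvPolynomial.esymm (Fin d) ℝ k) := by
    intro x k hk
    rw [← Polynomial.coeff_map, hW, hL, Polynomial.coeff_C_mul,
      Finset.prod_X_add_C_coeff _ _ (by simp)]
    simp [MvPolynomial.esymm, Nat.sub_sub_self hk]
  refine ⟨MvPolynomial.aeval (fun i : Fin d =>
    MvPolynomial.C (MvPolynomial.eval e P)⁻¹ * W.coeff (d - (i + 1))) F, fun x => ?_⟩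
  rw [hF']
  change MvPolynomial.aeval x _ = MvPolynomial.aeval (lm x) _
  rw [MvPolynomial.comp_aeval_apply, MvPolynomial.comp_aeval_apply]
  congr 2
  funext i
  rw [MvPolynomial.aeval_eq_eval, MvPolynomial.aeval_eq_eval]
  simp only [RingHom.coe_coe, map_mul, MvPolynomial.eval_C]
  rw [he x _ i.2, ← mul_assoc, inv_mul_cancel₀ hpe, one_mul]

lemma hyp_scale {n d : ℕ} (P : MvPolynomial (Fin n) ℝ) (e : Fin n → ℝ)
    (lm : (Fin n → ℝ) → Fin d → ℝ)
    (hhom : P.IsHomogeneous d)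
    (hpe : MvPolynomial.eval e P ≠ 0)
    (hroots : ∀ (x : Fin n → ℝ) (t : ℝ),
      MvPolynomial.eval (x - t • e) P = MvPolynomial.eval e P * ∏ i, (lm x i - t))
    (x : Fin n → ℝ) (c : ℝ) (hc : c ≠ 0) (t : ℝ) :
    ∏ i, (lm (c • x) i - t) = ∏ i, ((c • lm x) i - t) := by
  have h1 := hroots (c • x) t
  have h2 : c • x - t • e = c • (x - (t / c) • e) := by
    rw [smul_sub, smul_smul, mul_div_cancel₀ _ hc]
  have h3 := hyp_hom_smul hhom c (x - (t / c) • e)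
  simp only [MvPolynomial.aeval_eq_eval] at h3
  have h4 : (∏ i, ((c • lm x) i - t)) = c ^ d * ∏ i, (lm x i - t / c) := by
    have : c ^ d = ∏ i : Fin d, c := by simp
    rw [this, ← Finset.prod_mul_distrib]
    refine Finset.prod_congr rfl fun i _ => ?_
    simp only [Pi.smul_apply, smul_eq_mul]
    field_simp
  rw [h2] at h1
  have h3' : MvPolynomial.eval (c • (x - (t / c) • e)) P
      = c ^ d * MvPolynomial.eval (x - (t / c) • e) P := h3
  rw [h3', hroots] at h1
  rw [h4]
  refine mul_left_cancel₀ hpe ?_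
  rw [← h1]
  ring

lemma hyp_sym_hom {n d N : ℕ} (P : MvPolynomial (Fin n) ℝ) (e : Fin n → ℝ)
    (lm : (Fin n → ℝ) → Fin d → ℝ)
    (hhom : P.IsHomogeneous d)
    (hpe : MvPolynomial.eval e P ≠ 0)
    (hroots : ∀ (x : Fin n → ℝ) (t : ℝ),
      MvPolynomial.eval (x - t • e) P = MvPolynomial.eval e P * ∏ i, (lm x i - t))
    (S : MvPolynomial (Fin d) ℝ) (hS : S.IsSymmetric) (hSN : S.IsHomogeneous N) :
    ∃ R : MvPolynomial (Fin n) ℝ, R.IsHomogeneous N ∧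
      ∀ x, MvPolynomial.eval x R = MvPolynomial.eval (lm x) S := by
  obtain ⟨R, hR⟩ := hyp_sym_poly P e lm hpe hroots S hS
  refine ⟨MvPolynomial.homogeneousComponent N R,
    MvPolynomial.homogeneousComponent_isHomogeneous N R, fun x => ?_⟩
  have hsc : ∀ c : ℝ, c ≠ 0 → MvPolynomial.eval (c • x) R = c ^ N * MvPolynomial.eval x R := by
    intro c hc
    rw [hR, hR, hyp_prod_eq _ _ (hyp_scale P e lm hhom hpe hroots x c hc) S hS]
    exact hyp_hom_smul hSN c (lm x)
  have hsum : ∀ c : ℝ, MvPolynomial.eval (c • x) R = ∑ k ∈ Finset.range (R.totalDegree + 1),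
      MvPolynomial.eval x (MvPolynomial.homogeneousComponent k R) * c ^ k := by
    intro c
    conv_lhs => rw [← MvPolynomial.sum_homogeneousComponent R]
    rw [map_sum]
    refine Finset.sum_congr rfl fun k _ => ?_
    rw [mul_comm]
    exact hyp_hom_smul (MvPolynomial.homogeneousComponent_isHomogeneous k R) c x
  have hpoly : (∑ k ∈ Finset.range (R.totalDegree + 1),
      Polynomial.C (MvPolynomial.eval x (MvPolynomial.homogeneousComponent k R)) * Polynomial.X ^ k)
      = Polynomial.C (MvPolynomial.eval x R) * Polynomial.X ^ N := by
    refine Polynomial.eq_of_infinite_eval_eq _ _ ?_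
    refine (Set.Ioi_infinite (0 : ℝ)).mono ?_
    intro c hc
    simp only [Set.mem_ofPred_eq]
    rw [Polynomial.eval_finsetSum]
    simp only [Polynomial.eval_mul, Polynomial.eval_C, Polynomial.eval_pow, Polynomial.eval_X]
    rw [← hsum, hsc c (ne_of_gt hc), mul_comm]
  have h := congrArg (fun q => Polynomial.coeff q N) hpoly
  simp only [Polynomial.finsetSum_coeff, Polynomial.coeff_C_mul_X_pow] at h
  rw [← hR]
  simp only [if_true] at h
  rw [← h]
  by_cases hN : N < R.totalDegree + 1
  · rw [Finset.sum_ite_eq, if_pos (Finset.mem_range.2 hN)]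
  · rw [Finset.sum_ite_eq, if_neg (by simpa using hN),
      MvPolynomial.homogeneousComponent_eq_zero _ _ (by omega), map_zero]

lemma hyp_trace {n d : ℕ} (P : MvPolynomial (Fin n) ℝ) (e : Fin n → ℝ)
    (lm : (Fin n → ℝ) → Fin d → ℝ)
    (hhom : P.IsHomogeneous d)
    (hpe : MvPolynomial.eval e P ≠ 0)
    (hroots : ∀ (x : Fin n → ℝ) (t : ℝ),
      MvPolynomial.eval (x - t • e) P = MvPolynomial.eval e P * ∏ i, (lm x i - t))
    (x y : Fin n → ℝ) : ∑ i, lm (x + y) i = ∑ i, lm x i + ∑ i, lm y i := by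
  obtain ⟨R, hR, h⟩ := hyp_sym_hom (N := 1) P e lm hhom hpe hroots (∑ i, MvPolynomial.X i)
    (by intro σ; simp only [map_sum, MvPolynomial.rename_X]
        exact Equiv.sum_comp σ (fun i => (MvPolynomial.X i : MvPolynomial (Fin d) ℝ)))
    (MvPolynomial.IsHomogeneous.sum _ _ _ fun i _ => MvPolynomial.isHomogeneous_X _ _)
  simp only [map_sum, MvPolynomial.eval_X] at h
  obtain ⟨h1, h2⟩ := hypLine_deg hR x y
  have ev : ∀ t : ℝ, MvPolynomial.eval (x + t • y) R
      = (hypLine R x y).coeff 0 + (hypLine R x y).coeff 1 * t := by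
    intro t
    rw [← MvPolynomial.aeval_eq_eval]
    have := hypLine_eval R x y t
    rw [Polynomial.eval_eq_sum_range' (Nat.lt_succ_of_le h1)] at this
    simp only [Nat.succ_eq_add_one, Finset.sum_range_succ, Finset.sum_range_zero] at this
    simp only [← this]
    ring
  rw [MvPolynomial.aeval_eq_eval] at h2
  have h2' : _ = MvPolynomial.eval y R := h2
  have e0 := ev 0
  have e1 := ev 1
  simp only [zero_smul, one_smul, add_zero, h, h2'] at e0 e1
  linarith

lemma hyp_parallelogram {n d : ℕ} (P : MvPolynomial (Fin n) ℝ) (e : Fin n → ℝ)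
    (lm : (Fin n → ℝ) → Fin d → ℝ)
    (hhom : P.IsHomogeneous d)
    (hpe : MvPolynomial.eval e P ≠ 0)
    (hroots : ∀ (x : Fin n → ℝ) (t : ℝ),
      MvPolynomial.eval (x - t • e) P = MvPolynomial.eval e P * ∏ i, (lm x i - t))
    (x y : Fin n → ℝ) : ∑ i, lm (x + y) i ^ 2 + ∑ i, lm (x - y) i ^ 2
      = 2 * ∑ i, lm x i ^ 2 + 2 * ∑ i, lm y i ^ 2 := by
  obtain ⟨R, hR, h⟩ := hyp_sym_hom (N := 2) P e lm hhom hpe hroots (∑ i, MvPolynomial.X i ^ 2)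
    (by intro σ; simp only [map_sum, map_pow, MvPolynomial.rename_X]
        exact Equiv.sum_comp σ (fun i => (MvPolynomial.X i ^ 2 : MvPolynomial (Fin d) ℝ)))
    (MvPolynomial.IsHomogeneous.sum _ _ _ fun i _ => MvPolynomial.isHomogeneous_X_pow _ _)
  simp only [map_sum, map_pow, MvPolynomial.eval_X] at h
  obtain ⟨h1, h2⟩ := hypLine_deg hR x y
  have ev : ∀ t : ℝ, MvPolynomial.eval (x + t • y) R
      = (hypLine R x y).coeff 0 + (hypLine R x y).coeff 1 * t + (hypLine R x y).coeff 2 * t ^ 2 := by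
    intro t
    rw [← MvPolynomial.aeval_eq_eval]
    have := hypLine_eval R x y t
    rw [Polynomial.eval_eq_sum_range' (Nat.lt_succ_of_le h1)] at this
    simp only [Nat.succ_eq_add_one, Finset.sum_range_succ, Finset.sum_range_zero] at this
    simp only [← this]
    ring
  rw [MvPolynomial.aeval_eq_eval] at h2
  have h2' : _ = MvPolynomial.eval y R := h2
  have e0 := ev 0
  have e1 := ev 1
  have e2 := ev (-1)
  rw [show x + (-1 : ℝ) • y = x - y by simp [sub_eq_add_neg]] at e2
  simp only [zero_smul, one_smul, add_zero, h, h2'] at e0 e1 e2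
  linarith

lemma hyp_norm_le {n d : ℕ} (P : MvPolynomial (Fin n) ℝ) (e : Fin n → ℝ)
    (lm : (Fin n → ℝ) → Fin d → ℝ)
    (hhom : P.IsHomogeneous d)
    (hpe : MvPolynomial.eval e P ≠ 0)
    (hroots : ∀ (x : Fin n → ℝ) (t : ℝ),
      MvPolynomial.eval (x - t • e) P = MvPolynomial.eval e P * ∏ i, (lm x i - t))
    (hord : ∀ x, Antitone (lm x))
    (x y : Fin n → ℝ) :
    ∑ i, lm (x + y) i ^ 2 ≤ ∑ i, (lm x i + lm y i) ^ 2 := by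
  rcases Nat.eq_zero_or_pos d with hd | hd
  · subst hd; simp
  set v := lm (x + y) with hv
  set κ : ℝ := (1 - ∑ i, v i) / d with hκ
  set u : Fin d → ℝ := fun i => v i + κ with hu
  have hd' : (d : ℝ) ≠ 0 := by positivity
  have hU : ∑ i, u i = 1 := by
    simp only [hu, Finset.sum_add_distrib, Finset.sum_const, Finset.card_univ, Fintype.card_fin,
      nsmul_eq_mul, hκ]
    field_simp
    ring
  have hua : Antitone u := fun i j hij => by
    have := hord (x + y) hij
    simp only [hu, hv]
    linarith
  let S : MvPolynomial (Fin d) ℝ := ∏ π : Equiv.Perm (Fin d),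
    ∑ i, MvPolynomial.C (u i) * MvPolynomial.X (π i)
  have hSsym : S.IsSymmetric := by
    intro σ
    simp only [S, map_prod, map_sum, map_mul, MvPolynomial.rename_X, MvPolynomial.rename_C]
    exact Equiv.prod_comp (Equiv.mulLeft σ) (fun π : Equiv.Perm (Fin d) =>
      ∑ i, MvPolynomial.C (u i) * (MvPolynomial.X (π i) : MvPolynomial (Fin d) ℝ))
  have hShom : S.IsHomogeneous (Fintype.card (Equiv.Perm (Fin d))) := by
    have := MvPolynomial.IsHomogeneous.prod (Finset.univ : Finset (Equiv.Perm (Fin d)))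
      (fun π => ∑ i, MvPolynomial.C (u i) * (MvPolynomial.X (π i) : MvPolynomial (Fin d) ℝ))
      (fun _ => 1) (fun π _ => MvPolynomial.IsHomogeneous.sum _ _ _ fun i _ =>
        MvPolynomial.isHomogeneous_C_mul_X _ _)
    simpa using this
  obtain ⟨R, hR, hRe⟩ := hyp_sym_hom P e lm hhom hpe hroots S hSsym hShom
  let μ : (Fin n → ℝ) → Equiv.Perm (Fin d) → ℝ := fun z π => ∑ i, u i * lm z (π i)
  have hyp : ∀ z (t : ℝ), MvPolynomial.eval (z - t • e) R = ∏ π, (μ z π - t) := by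
    intro z t
    rw [hRe]
    have h1 := hyp_prod_eq (lm (z - t • e)) (fun i => lm z i - t) (fun s => by
      have h2 := hroots (z - t • e) s
      have h3 := hroots z (t + s)
      rw [show z - (t + s) • e = z - t • e - s • e by rw [add_smul]; abel, h2] at h3
      rw [mul_left_cancel₀ hpe h3]
      refine Finset.prod_congr rfl fun i _ => ?_
      ring) S hSsym
    rw [h1]
    simp only [S, map_prod, map_sum, map_mul, MvPolynomial.eval_X, MvPolynomial.eval_C]
    refine Finset.prod_congr rfl fun π _ => ?_
    simp only [μ, mul_sub, Finset.sum_sub_distrib, ← Finset.sum_mul, hU, one_mul]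
  have hmax : ∀ z π, μ z π ≤ ∑ i, u i * lm z i := fun z π => by
    have hm : Monovary u (lm z) := by
      intro i j hij
      have : j ≤ i := by
        by_contra hc
        exact absurd (hord z (not_le.1 hc).le) (not_le.2 hij)
      exact hua this
    exact hm.sum_mul_comp_perm_le_sum_mul
  have hsub := hyp_subadd R hR e μ hyp x y _ _ (hmax x) (hmax y) 1
  have htr := hyp_trace P e lm hhom hpe hroots x y
  simp only [μ, hu, add_mul, Finset.sum_add_distrib, ← Finset.mul_sum, Equiv.Perm.coe_one, id] at hsub
  rw [htr] at hsub
  have hkey : ∑ i, v i * v i ≤ ∑ i, v i * (lm x i + lm y i) := by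
    simp only [mul_add, Finset.sum_add_distrib]
    linarith
  have hsq : 0 ≤ ∑ i, (lm x i + lm y i - v i) ^ 2 := Finset.sum_nonneg fun i _ => sq_nonneg _
  have hexp : ∑ i, (lm x i + lm y i - v i) ^ 2 = ∑ i, (lm x i + lm y i) ^ 2
      - 2 * ∑ i, v i * (lm x i + lm y i) + ∑ i, v i * v i := by
    rw [Finset.mul_sum, ← Finset.sum_sub_distrib, ← Finset.sum_add_distrib]
    refine Finset.sum_congr rfl fun i _ => ?_
    ring
  have : ∑ i, v i ^ 2 = ∑ i, v i * v i := Finset.sum_congr rfl fun i _ => by ring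
  rw [this]
  linarith


/-- If `p` is a complete isometric hyperbolic polynomial of degree `d`
along `e` with eigenvalue map `lm`, then for every `u` in the range of `lm` and every
`x`, the Euclidean distance `‖u - λ(x)‖₂` equals the `‖·‖_p`-distance from `x` to the
fiber `λ⁻¹(u)`, where `‖y‖_p = ‖λ(y)‖₂`. -/
theorem stmt_2 {n d : ℕ}
    (P : MvPolynomial (Fin n) ℝ) (e : Fin n → ℝ)
    (lm : (Fin n → ℝ) → Fin d → ℝ)
    (hhom : P.IsHomogeneous d)
    (hpe : MvPolynomial.eval e P ≠ 0)
    (hroots : ∀ (x : Fin n → ℝ) (t : ℝ),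
      MvPolynomial.eval (x - t • e) P = MvPolynomial.eval e P * ∏ i, (lm x i - t))
    (hord : ∀ x, Antitone (lm x))
    (hcomplete : ∀ x, lm x = 0 → x = 0)
    (hiso : ∀ y z : Fin n → ℝ, ∃ x, lm x = lm z ∧ lm (x + y) = lm x + lm y)
    (u : Fin d → ℝ) (hu : u ∈ Set.range lm) (x : Fin n → ℝ) :
    sInf {r : ℝ | ∃ y : Fin n → ℝ, lm y = u ∧ r = Real.sqrt (∑ i, lm (y - x) i ^ 2)}
      = Real.sqrt (∑ i, (u i - lm x i) ^ 2) := by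
  have hsq : ∀ a b : Fin d → ℝ, ∑ i, (a i - b i) ^ 2 + ∑ i, (b i + a i) ^ 2
      = 2 * ∑ i, a i ^ 2 + 2 * ∑ i, b i ^ 2 := by
    intro a b
    rw [Finset.mul_sum, Finset.mul_sum, ← Finset.sum_add_distrib, ← Finset.sum_add_distrib]
    refine Finset.sum_congr rfl fun i _ => ?_
    ring
  refine IsLeast.csInf_eq ⟨?_, ?_⟩
  · obtain ⟨z, rfl⟩ := hu
    obtain ⟨w, hw, hadd⟩ := hiso x z
    refine ⟨w, hw, ?_⟩
    congr 1
    have h1 := hyp_parallelogram P e lm hhom hpe hroots w x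
    have h2 := hsq (lm w) (lm x)
    have h3 : ∑ i, lm (w + x) i ^ 2 = ∑ i, (lm x i + lm w i) ^ 2 := by
      refine Finset.sum_congr rfl fun i _ => ?_
      rw [hadd, Pi.add_apply, add_comm]
    rw [← hw]
    linarith
  · rintro r ⟨w, rfl, rfl⟩
    refine Real.sqrt_le_sqrt ?_
    have h1 := hyp_parallelogram P e lm hhom hpe hroots w x
    have h2 := hsq (lm w) (lm x)
    have h3 := hyp_norm_le P e lm hhom hpe hroots hord x w
    rw [add_comm x w] at h3
    linarith
end

section
/- Let Λ = Λ(p,e) be a hyperbolicity cone with p complete, isometric and λ(ℝ^n) = ℝ^d_↓. Define f : ℝ^d → ℝ by f(u) := (1/2) Σ_{i=1}^d max(u_i, 0)^2. Then f ∘ λ is convex and differentiable on ℝ^n, and for every x ∈ ℝ^n the projection of x onto Λ with respect to the norm ‖·‖_p satisfies P_Λ(x) = ∇(f ∘ λ)(x), where the gradient is taken with respect to the inner product ⟨·,·⟩_p. -/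
open Polynomial

/-- factorization of a polynomial nonvanishing at zero -/
lemma aux_factor (k : ℕ) : ∀ (G : ℂ[X]), G.natDegree ≤ k → G.eval 0 ≠ 0 →
    ∃ m : Multiset ℂ, Multiset.card m ≤ k ∧ (∀ τ ∈ m, τ ≠ 0 ∧ G.eval (-τ⁻¹) = 0) ∧
      G = C (G.eval 0) * (m.map (fun τ => 1 + C τ * X)).prod := by
  induction k with
  | zero =>
    intro G hd h0
    refine ⟨0, by simp, by simp, ?_⟩
    have := eq_C_of_natDegree_le_zero hd
    rw [this]; simp
  | succ k ih =>
    intro G hd h0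
    by_cases hc : G.natDegree = 0
    · refine ⟨0, by simp, by simp, ?_⟩
      have := eq_C_of_natDegree_le_zero hc.le
      rw [this]; simp
    · obtain ⟨z, hz⟩ := Complex.exists_root (f := G) (by
        apply natDegree_pos_iff_degree_pos.1; omega)
      have hz0 : z ≠ 0 := by
        rintro rfl; exact h0 hz
      obtain ⟨K, hK⟩ := dvd_iff_isRoot.2 hz
      have hK0 : K ≠ 0 := by rintro rfl; simp [hK] at h0
      have hdeg : G.natDegree = 1 + K.natDegree := by
        rw [hK, natDegree_mul (X_sub_C_ne_zero z) hK0, natDegree_X_sub_C]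
      have hG0 : G.eval 0 = -z * K.eval 0 := by rw [hK]; simp
      have hk0 : K.eval 0 ≠ 0 := by
        intro h; apply h0; rw [hG0, h, mul_zero]
      obtain ⟨m, h1, h2, h3⟩ := ih K (by omega) hk0
      refine ⟨(-z⁻¹) ::ₘ m, by simpa using h1, ?_, ?_⟩
      · intro τ hτ
        rcases Multiset.mem_cons.1 hτ with rfl | hτ
        · refine ⟨by simpa using hz0, ?_⟩
          have : -(-z⁻¹)⁻¹ = z := by rw [inv_neg, inv_inv, neg_neg]
          rw [this]; exact hz
        · refine ⟨(h2 τ hτ).1, ?_⟩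
          rw [hK, eval_mul, (h2 τ hτ).2, mul_zero]
      · rw [hG0, Multiset.map_cons, Multiset.prod_cons]
        conv_lhs => rw [hK, h3]
        have : (X - C z : ℂ[X]) = C (-z) * (1 + C (-z⁻¹) * X) := by
          have : C z * C z⁻¹ = (1 : ℂ[X]) := by rw [← C_mul, mul_inv_cancel₀ hz0, C_1]
          simp only [C_neg]
          linear_combination -X * this
        rw [this, C_mul]; ring

lemma aux_coeff (m : Multiset ℂ) :
    ((m.map (fun τ => 1 + C τ * X)).prod.coeff 0 = 1) ∧
    ((m.map (fun τ => 1 + C τ * X)).prod.coeff 1 = m.sum) ∧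
    (2 * (m.map (fun τ => 1 + C τ * X)).prod.coeff 2 = m.sum ^ 2 - (m.map (fun τ => τ ^ 2)).sum) := by
  induction m using Multiset.induction with
  | empty => simp [coeff_one]
  | cons a m ih =>
    obtain ⟨h0, h1, h2⟩ := ih
    simp only [Multiset.map_cons, Multiset.prod_cons, Multiset.sum_cons]
    set R := (m.map (fun τ => 1 + C τ * X)).prod
    have e : (1 + C a * X) * R = R + C a * (R * X) := by ring
    rw [e]
    refine ⟨?_, ?_, ?_⟩
    · simp [h0]
    · simp only [coeff_add, coeff_C_mul, coeff_mul_X, h0, h1]; ring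
    · simp only [coeff_add, coeff_C_mul, coeff_mul_X, h1]
      linear_combination h2

lemma aux_persist (k : ℕ) (G : ℂ[X]) (hd : G.natDegree ≤ k) (s : ℂ) (hs : 0 < s.im)
    (h : ‖G.eval s‖ < (s.im / ‖s‖) ^ k * ‖G.eval 0‖) : ∃ ρ : ℂ, 0 < ρ.im ∧ G.eval ρ = 0 := by
  have h0 : G.eval 0 ≠ 0 := by
    intro h0; rw [h0] at h; simp at h; exact absurd h (not_lt.2 (norm_nonneg _))
  have hs0 : s ≠ 0 := by rintro rfl; simp at hs
  have hsn : 0 < ‖s‖ := norm_pos_iff.2 hs0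
  set ε := s.im / ‖s‖ with hε
  have hε0 : 0 < ε := by positivity
  have hε1 : ε ≤ 1 := by
    rw [hε, div_le_one hsn]; exact (le_abs_self _).trans (Complex.abs_im_le_norm s)
  obtain ⟨m, h1, h2, h3⟩ := aux_factor k G hd h0
  have : ∃ τ ∈ m, ‖1 + τ * s‖ < ε := by
    by_contra hcon
    push Not at hcon
    have key : ∀ m : Multiset ℂ, (∀ τ ∈ m, ε ≤ ‖1 + τ * s‖) →
        ε ^ (Multiset.card m) ≤ ‖((m.map (fun τ => 1 + C τ * X)).prod).eval s‖ := by
      intro m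
      induction m using Multiset.induction with
      | empty => simp
      | cons a m ih =>
        intro hm
        simp only [Multiset.map_cons, Multiset.prod_cons, Multiset.card_cons, eval_mul, norm_mul]
        rw [pow_succ']
        have := ih (fun τ hτ => hm τ (Multiset.mem_cons_of_mem hτ))
        have h' := hm a (Multiset.mem_cons_self a m)
        simp only [eval_add, eval_one, eval_mul, eval_C, eval_X]
        gcongr
    have k1 := key m hcon
    have k2 : ε ^ k ≤ ε ^ (Multiset.card m) := pow_le_pow_of_le_one hε0.le hε1 h1
    have k3 : ‖G.eval s‖ = ‖G.eval 0‖ * ‖((m.map (fun τ => 1 + C τ * X)).prod).eval s‖ := by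
      conv_lhs => rw [h3]
      rw [eval_mul, eval_C, norm_mul]
    rw [k3, mul_comm] at h
    have := mul_le_mul_of_nonneg_right (k2.trans k1) (norm_nonneg (G.eval 0))
    linarith
  obtain ⟨τ, hτ, hlt⟩ := this
  refine ⟨-τ⁻¹, ?_, (h2 τ hτ).2⟩
  have hτ0 := (h2 τ hτ).1
  -- im τ > 0
  have hn : 0 < Complex.normSq s := Complex.normSq_pos.2 hs0
  have e1 : τ + s⁻¹ = (1 + τ * s) * s⁻¹ := by field_simp; ring
  have e2 : ‖τ + s⁻¹‖ < s.im / Complex.normSq s := by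
    rw [e1, norm_mul, norm_inv, Complex.normSq_eq_norm_sq]
    calc ‖1 + τ * s‖ * ‖s‖⁻¹ < ε * ‖s‖⁻¹ := by gcongr
      _ = s.im / ‖s‖ ^ 2 := by rw [hε]; field_simp
  have e3 := (abs_le.1 (Complex.abs_im_le_norm (τ + s⁻¹))).1
  rw [Complex.add_im, Complex.inv_im, neg_div] at e3
  have e4 : 0 < τ.im := by linarith
  rw [Complex.neg_im, Complex.inv_im, neg_div, neg_neg]
  exact div_pos e4 (Complex.normSq_pos.2 hτ0)

noncomputable def lineP {n : ℕ} (Q : MvPolynomial (Fin n) ℂ) (a b : Fin n → ℂ) : ℂ[X] :=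
  MvPolynomial.aeval (fun i => C (a i) + C (b i) * X) Q

lemma lineP_eval {n : ℕ} (Q : MvPolynomial (Fin n) ℂ) (a b : Fin n → ℂ) (s : ℂ) :
    (lineP Q a b).eval s = MvPolynomial.eval (a + s • b) Q := by
  unfold lineP
  induction Q using MvPolynomial.induction_on with
  | C r => simp
  | add p q hp hq => simp only [map_add, eval_add, hp, hq]
  | mul_X p i hp =>
    simp only [map_mul, eval_mul, hp, MvPolynomial.aeval_X, MvPolynomial.eval_X]
    simp only [eval_add, eval_mul, eval_C, eval_X, Pi.add_apply, Pi.smul_apply, smul_eq_mul]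
    ring

lemma lineP_natDegree {n d : ℕ} (Q : MvPolynomial (Fin n) ℂ) (hQ : Q.IsHomogeneous d)
    (a b : Fin n → ℂ) : (lineP Q a b).natDegree ≤ d := by
  have := MvPolynomial.aeval_natDegree_le (m := d) (n := 1) Q hQ.totalDegree_le
    (fun i => C (a i) + C (b i) * X) (fun i => by compute_degree)
  simpa [lineP] using this

lemma hom_eval {n d : ℕ} {R : Type*} [CommRing R] (Q : MvPolynomial (Fin n) R)
    (hQ : Q.IsHomogeneous d) (s : R) (w : Fin n → R) :
    MvPolynomial.eval (s • w) Q = s ^ d * MvPolynomial.eval w Q := by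
  rw [MvPolynomial.eval_eq, MvPolynomial.eval_eq, Finset.mul_sum]
  refine Finset.sum_congr rfl fun m hm => ?_
  have h1 : ∑ i ∈ m.support, m i = d := by
    have := hQ (MvPolynomial.mem_support_iff.1 hm)
    rw [Finsupp.weight_apply] at this
    simpa [Finsupp.sum] using this
  simp only [Pi.smul_apply, smul_eq_mul, mul_pow, Finset.prod_mul_distrib,
    Finset.prod_pow_eq_pow_sum, h1]
  ring

lemma lineP_coeff {n : ℕ} (Q : MvPolynomial (Fin n) ℂ) (a : Fin n → ℂ) :
    ∃ (L : (Fin n → ℂ) →ₗ[ℂ] ℂ) (Φ : (Fin n → ℂ) →ₗ[ℂ] (Fin n → ℂ) →ₗ[ℂ] ℂ), ∀ w,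
      (lineP Q a w).coeff 0 = MvPolynomial.eval a Q ∧
      (lineP Q a w).coeff 1 = L w ∧ (lineP Q a w).coeff 2 = Φ w w := by
  unfold lineP
  induction Q using MvPolynomial.induction_on with
  | C r => exact ⟨0, 0, fun w => by simp [coeff_C]⟩
  | add p q hp hq =>
    obtain ⟨L, Φ, h⟩ := hp
    obtain ⟨L', Φ', h'⟩ := hq
    refine ⟨L + L', Φ + Φ', fun w => ?_⟩
    simp [h w, h' w]
  | mul_X p i hp =>
    obtain ⟨L, Φ, h⟩ := hp
    refine ⟨a i • L + MvPolynomial.eval a p • LinearMap.proj i,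
      a i • Φ + (LinearMap.proj (R := ℂ) (φ := fun _ : Fin n => ℂ) i).smulRight L, fun w => ?_⟩
    obtain ⟨h0, h1, h2⟩ := h w
    set R := (MvPolynomial.aeval (fun i => C (a i) + C (w i) * X)) p
    have e : (MvPolynomial.aeval (fun i => C (a i) + C (w i) * X)) (p * MvPolynomial.X i)
        = C (a i) * R + C (w i) * (R * X) := by
      rw [map_mul, MvPolynomial.aeval_X]; ring
    rw [e]
    refine ⟨?_, ?_, ?_⟩
    · simp only [coeff_add, coeff_C_mul, h0, coeff_mul_X_zero]; simp [mul_comm]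
    · simp only [coeff_add, coeff_C_mul, coeff_mul_X, h0, h1]; simp [mul_comm]
    · simp only [coeff_add, coeff_C_mul, coeff_mul_X, h1, h2]; simp

/-- The quadratic form given by the sum of the squared eigenvalues. -/
lemma exists_quad {n : ℕ} (Q : MvPolynomial (Fin n) ℂ) (a : Fin n → ℂ)
    (ha : MvPolynomial.eval a Q ≠ 0) :
    ∃ Φ : (Fin n → ℂ) →ₗ[ℂ] (Fin n → ℂ) →ₗ[ℂ] ℂ, ∀ w, ∀ m : Multiset ℂ,
      lineP Q a w = C (MvPolynomial.eval a Q) * (m.map (fun τ => 1 + C τ * X)).prod →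
      (m.map (fun τ => τ ^ 2)).sum = Φ w w := by
  obtain ⟨L, Φ, h⟩ := lineP_coeff Q a
  set c := MvPolynomial.eval a Q
  refine ⟨(c⁻¹ ^ 2) • L.smulRight L - (2 * c⁻¹) • Φ, fun w m hm => ?_⟩
  obtain ⟨-, h1, h2⟩ := h w
  obtain ⟨-, k1, k2⟩ := aux_coeff m
  rw [hm, coeff_C_mul] at h1 h2
  rw [k1] at h1
  simp only [LinearMap.sub_apply, LinearMap.smul_apply, LinearMap.smulRight_apply, smul_eq_mul,
    ← h1, ← h2]
  field_simp
  linear_combination k2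

def cx {n : ℕ} (x : Fin n → ℝ) : Fin n → ℂ := fun i => (x i : ℂ)

lemma lemmaA {n d : ℕ} (Q : MvPolynomial (Fin n) ℂ) (hQ : Q.IsHomogeneous d)
    (e : Fin n → ℝ) (lm : (Fin n → ℝ) → Fin d → ℝ) (c : ℂ) (hc : c ≠ 0)
    (hr : ∀ (x : Fin n → ℝ) (a b : ℂ),
      MvPolynomial.eval (a • cx e + b • cx x) Q = c * ∏ i, (a + b * (lm x i : ℂ)))
    (x y : Fin n → ℝ) (hx : ∀ i, 0 < lm x i) (δ : ℝ) (hδ : 0 < δ) (s : ℂ) (hs : 0 ≤ s.im) :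
    MvPolynomial.eval (cx y + s • cx x + (Complex.I * δ) • cx e) Q ≠ 0 := by
  intro hzero
  have hIδ : (Complex.I * δ) ≠ 0 := by simp [hδ.ne']
  -- no zeros on the real line
  have hreal : ∀ v : Fin n → ℝ, MvPolynomial.eval ((Complex.I * δ) • cx e + cx v) Q ≠ 0 := by
    intro v h
    have := hr v (Complex.I * δ) 1
    rw [one_smul, h] at this
    rcases mul_eq_zero.1 this.symm with h' | h'
    · exact hc h'
    · obtain ⟨i, -, hi⟩ := Finset.prod_eq_zero_iff.1 h'
      have := congrArg Complex.im hi
      simp at this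
      exact hδ.ne' this
  have hx0 : MvPolynomial.eval (cx x) Q ≠ 0 := by
    have := hr x 0 1
    rw [zero_smul, zero_add, one_smul] at this
    rw [this]
    refine mul_ne_zero hc (Finset.prod_ne_zero_iff.2 fun i _ => ?_)
    simp [(hx i).ne']
  let V : ℝ → Fin n → ℂ := fun θ => (Complex.I * δ) • cx e + cx (θ • y)
  have hcx : Continuous (fun θ : ℝ => cx (θ • y)) := by
    unfold cx; fun_prop
  have hV : Continuous V := continuous_const.add hcx
  let K : Set (ℝ × ℂ) := {p | p.1 ∈ Set.Icc (0:ℝ) 1 ∧ 0 ≤ p.2.im ∧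
    MvPolynomial.eval (V p.1 + p.2 • cx x) Q = 0}
  have hF : Continuous (fun p : ℝ × ℂ => MvPolynomial.eval (V p.1 + p.2 • cx x) Q) := by
    refine (MvPolynomial.continuous_eval Q).comp ?_
    exact (hV.comp continuous_fst).add (continuous_snd.smul continuous_const)
  have hKc : IsClosed K := by
    refine IsClosed.inter (isClosed_Icc.preimage continuous_fst) (IsClosed.inter ?_ ?_)
    · exact isClosed_le continuous_const (Complex.continuous_im.comp continuous_snd)
    · exact isClosed_eq hF continuous_const
  -- bounded
  obtain ⟨ε, hε, hball⟩ : ∃ ε > 0, ∀ v : Fin n → ℂ, ‖v‖ < ε →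
      MvPolynomial.eval (cx x + v) Q ≠ 0 := by
    have hcont : Continuous (fun v : Fin n → ℂ => MvPolynomial.eval (cx x + v) Q) :=
      (MvPolynomial.continuous_eval Q).comp (continuous_const.add continuous_id)
    have : ∀ᶠ v in nhds (0 : Fin n → ℂ), MvPolynomial.eval (cx x + v) Q ≠ 0 :=
      hcont.continuousAt.eventually_ne (by simpa using hx0)
    obtain ⟨ε, hε, h⟩ := Metric.eventually_nhds_iff.1 this
    exact ⟨ε, hε, fun v hv => h (by simpa using hv)⟩
  obtain ⟨M, hM⟩ : ∃ M, ∀ θ ∈ Set.Icc (0:ℝ) 1, ‖V θ‖ ≤ M :=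
    (isCompact_Icc (a := (0:ℝ)) (b := 1)).exists_bound_of_continuousOn hV.continuousOn
  have hM0 : 0 ≤ M := (norm_nonneg _).trans (hM 0 (by simp))
  have hKb : K ⊆ Set.Icc (0:ℝ) 1 ×ˢ Metric.closedBall (0:ℂ) (M / ε) := by
    rintro ⟨θ, s⟩ ⟨h1, h2, h3⟩
    refine ⟨h1, ?_⟩
    simp only [mem_closedBall_zero_iff]
    by_contra hcon
    push Not at hcon
    have hsn : 0 < ‖s‖ := lt_of_le_of_lt (by positivity) hcon
    have hs0 : s ≠ 0 := norm_pos_iff.1 hsn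
    refine hball (s⁻¹ • V θ) ?_ ?_
    · rw [norm_smul, norm_inv, inv_mul_lt_iff₀ hsn]
      rw [div_lt_iff₀ hε] at hcon
      exact (hM θ h1).trans_lt hcon
    · have : cx x + s⁻¹ • V θ = s⁻¹ • (V θ + s • cx x) := by
        rw [smul_add _ (V θ), smul_smul s⁻¹ s, inv_mul_cancel₀ hs0, one_smul, add_comm]
      rw [this, hom_eval Q hQ]
      simp only at h3
      rw [h3, mul_zero]
  have hKK : IsCompact K :=
    (isCompact_Icc.prod (isCompact_closedBall (0:ℂ) (M / ε))).of_isClosed_subset hKc hKb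
  have hne : K.Nonempty := by
    refine ⟨(1, s), by simp, hs, ?_⟩
    simp only [V, one_smul]
    rw [← hzero]; congr 2; abel
  obtain ⟨⟨θ, z⟩, ⟨hθ, hz, hroot⟩, hmin⟩ := hKK.exists_isMinOn hne continuous_fst.continuousOn
  simp only at hθ hz hroot
  have hθ0 : 0 < θ := by
    rcases hθ.1.lt_or_eq with h | h
    · exact h
    exfalso
    subst h
    have e1 : V 0 + z • cx x = (Complex.I * δ) • cx e + z • cx x := by
      have : cx ((0:ℝ) • y) = 0 := by ext i; simp [cx]
      simp only [V]; rw [this, add_zero]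
    rw [e1, hr] at hroot
    rcases mul_eq_zero.1 hroot with h' | h'
    · exact hc h'
    · obtain ⟨i, -, hi⟩ := Finset.prod_eq_zero_iff.1 h'
      have := congrArg Complex.im hi
      simp at this
      nlinarith [hx i, mul_nonneg hz (hx i).le]
  have hz0 : 0 < z.im := by
    rcases hz.lt_or_eq with h | h
    · exact h
    exfalso
    refine hreal (θ • y + z.re • x) ?_
    rw [← hroot]; congr 2
    ext i
    have hzr : z = (z.re : ℂ) := by apply Complex.ext <;> simp [← h]
    simp only [V, cx, Pi.add_apply, Pi.smul_apply, smul_eq_mul]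
    rw [hzr]; push_cast; simp; ring
  -- persistence
  have hzn : z ≠ 0 := by rintro rfl; simp at hz0
  have hev : ∀ᶠ θ' in nhds θ, ‖(lineP Q (V θ') (cx x)).eval z‖ <
      (z.im / ‖z‖) ^ d * ‖(lineP Q (V θ') (cx x)).eval 0‖ := by
    simp only [lineP_eval]
    have c1 : Continuous fun θ' : ℝ => ‖MvPolynomial.eval (V θ' + z • cx x) Q‖ :=
      (hF.comp (continuous_id.prodMk continuous_const)).norm
    have c2 : Continuous fun θ' : ℝ => (z.im / ‖z‖) ^ d * ‖MvPolynomial.eval (V θ' + (0:ℂ) • cx x) Q‖ :=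
      continuous_const.mul (hF.comp (continuous_id.prodMk continuous_const)).norm
    refine c1.continuousAt.eventually_lt c2.continuousAt ?_
    rw [hroot, norm_zero, zero_smul, add_zero]
    have := norm_pos_iff.2 (hreal (θ • y))
    have h2 : 0 < ‖z‖ := norm_pos_iff.2 hzn
    positivity
  obtain ⟨θ', hθ', h1, h2⟩ : ∃ θ', (‖(lineP Q (V θ') (cx x)).eval z‖ <
      (z.im / ‖z‖) ^ d * ‖(lineP Q (V θ') (cx x)).eval 0‖) ∧ 0 < θ' ∧ θ' < θ := by
    have hev2 : ∀ᶠ θ' in nhdsWithin θ (Set.Iio θ), 0 < θ' ∧ θ' < θ :=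
      (Filter.Eventually.filter_mono nhdsWithin_le_nhds (lt_mem_nhds hθ0)).and self_mem_nhdsWithin
    exact ((hev.filter_mono nhdsWithin_le_nhds).and hev2).exists
  obtain ⟨ρ, hρ, hρ0⟩ := aux_persist d _ (lineP_natDegree Q hQ _ _) z hz0 hθ'
  rw [lineP_eval] at hρ0
  have := hmin (show (θ', ρ) ∈ K from ⟨⟨h1.le, h2.le.trans hθ.2⟩, hρ.le, hρ0⟩)
  simp at this
  linarith

lemma cx_add {n : ℕ} (x y : Fin n → ℝ) : cx (x + y) = cx x + cx y := by
  ext i; simp [cx]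

lemma cx_smul {n : ℕ} (r : ℝ) (x : Fin n → ℝ) : cx (r • x) = (r : ℂ) • cx x := by
  ext i; simp [cx]

lemma exists_form {n d : ℕ} (Q : MvPolynomial (Fin n) ℂ) (hQ : Q.IsHomogeneous d)
    (e : Fin n → ℝ) (lm : (Fin n → ℝ) → Fin d → ℝ) (c : ℂ) (hc : c ≠ 0)
    (hr : ∀ (x : Fin n → ℝ) (a b : ℂ),
      MvPolynomial.eval (a • cx e + b • cx x) Q = c * ∏ i, (a + b * (lm x i : ℂ)))
    (hconj : ∀ w : Fin n → ℂ, MvPolynomial.eval (fun i => (starRingEnd ℂ) (w i)) Q =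
      (starRingEnd ℂ) (MvPolynomial.eval w Q)) :
    ∃ B : (Fin n → ℝ) →ₗ[ℝ] (Fin n → ℝ) →ₗ[ℝ] ℝ, (∀ x y, B x y = B y x) ∧
      (∀ x, B x x = ∑ i, lm x i ^ 2) ∧
      (∀ x y, (∀ i, 0 < lm x i) → (∀ i, 0 < lm y i) → 0 ≤ B x y) := by
  have hce : MvPolynomial.eval (cx e) Q = c := by
    have e0 := hr 0 1 0
    simpa using e0
  obtain ⟨Φ, hΦ⟩ := exists_quad Q (cx e) (by rw [hce]; exact hc)
  rw [hce] at hΦ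
  have hq : ∀ x, Φ (cx x) (cx x) = ((∑ i, lm x i ^ 2 : ℝ) : ℂ) := by
    intro x
    rw [← hΦ (cx x) (Finset.univ.val.map (fun i => (lm x i : ℂ)))]
    · rw [Multiset.map_map]
      change ∑ i, ((lm x i : ℂ)) ^ 2 = _
      push_cast; rfl
    · apply Polynomial.funext
      intro s
      have := hr x 1 s
      rw [one_smul] at this
      rw [lineP_eval, this, eval_mul, eval_C, Multiset.map_map]
      congr 1
      change _ = eval s (∏ i, (1 + C (lm x i : ℂ) * X))
      rw [eval_prod]
      refine Finset.prod_congr rfl fun i _ => ?_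
      rw [eval_add, eval_one, eval_mul, eval_C, eval_X, mul_comm]
  let B : (Fin n → ℝ) →ₗ[ℝ] (Fin n → ℝ) →ₗ[ℝ] ℝ := LinearMap.mk₂ ℝ
    (fun x y => (Φ (cx x) (cx y) + Φ (cx y) (cx x)).re / 2)
    (by intro x y z; simp only [cx_add, map_add, LinearMap.add_apply, Complex.add_re]; ring)
    (by intro r x y
        simp only [cx_smul, map_smul, LinearMap.smul_apply, smul_eq_mul, Complex.add_re,
          Complex.re_ofReal_mul]; ring)
    (by intro x y z; simp only [cx_add, map_add, LinearMap.add_apply, Complex.add_re]; ring)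
    (by intro r x y
        simp only [cx_smul, map_smul, LinearMap.smul_apply, smul_eq_mul, Complex.add_re,
          Complex.re_ofReal_mul]; ring)
  have hB : ∀ x y, B x y = (Φ (cx x) (cx y) + Φ (cx y) (cx x)).re / 2 := fun x y => rfl
  refine ⟨B, fun x y => by rw [hB, hB, add_comm], fun x => ?_, fun x y hx hy => ?_⟩
  · rw [hB, hq, Complex.add_re, Complex.ofReal_re]; ring
  · set w : Fin n → ℂ := cx y + Complex.I • cx x with hw
    have hl0 : (lineP Q (cx e) w).eval 0 = c := by
      rw [lineP_eval, zero_smul, add_zero, hce]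
    obtain ⟨m, -, hm1, hm2⟩ := aux_factor d (lineP Q (cx e) w) (lineP_natDegree Q hQ _ _)
      (by rw [hl0]; exact hc)
    rw [hl0] at hm2
    have hsum := hΦ w m hm2
    have h1 : (Φ w w).im = 2 * B x y := by
      rw [hB, hw]
      simp only [map_add, map_smul, LinearMap.add_apply, LinearMap.smul_apply, smul_eq_mul, hq]
      simp only [Complex.add_im, Complex.add_re, Complex.mul_im, Complex.mul_re, Complex.I_re,
        Complex.I_im, Complex.ofReal_im, Complex.ofReal_re]
      ring
    have h2 : ∀ τ ∈ m, 0 ≤ (τ ^ 2).im := by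
      intro τ hτ
      obtain ⟨hτ0, hτ1⟩ := hm1 τ hτ
      have hz : MvPolynomial.eval (w - τ • cx e) Q = 0 := by
        have : w - τ • cx e = (-τ) • (cx e + (-τ⁻¹) • w) := by
          ext i; simp; field_simp; ring
        rw [this, hom_eval Q hQ, ← lineP_eval, hτ1, mul_zero]
      have him : 0 ≤ τ.im := by
        by_contra hneg
        push Not at hneg
        refine lemmaA Q hQ e lm c hc hr x (y + (-τ.re) • e) hx (-τ.im) (by linarith) Complex.I
          (by simp) ?_
        rw [← hz]; congr 2
        ext i
        simp only [cx, hw, Pi.add_apply, Pi.smul_apply, smul_eq_mul, Pi.sub_apply]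
        conv_rhs => rw [← Complex.re_add_im τ]
        push_cast; ring
      have hre : 0 ≤ τ.re := by
        by_contra hneg
        push Not at hneg
        refine lemmaA Q hQ e lm c hc hr y (x + (-τ.im) • e) hy (-τ.re) (by linarith) Complex.I
          (by simp) ?_
        have key : cx (x + (-τ.im) • e) + Complex.I • cx y + (Complex.I * ((-τ.re : ℝ) : ℂ)) • cx e
            = fun i => (starRingEnd ℂ) (((-Complex.I) • (w - τ • cx e)) i) := by
          ext i
          simp only [cx, hw, Pi.add_apply, Pi.smul_apply, smul_eq_mul, Pi.sub_apply]
          apply Complex.ext <;> simp <;> ring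
        rw [key, hconj, hom_eval Q hQ, hz, mul_zero, map_zero]
      rw [sq, Complex.mul_im]
      positivity
    have h3 : 0 ≤ ((m.map (fun τ => τ ^ 2)).sum).im := by
      have : ∀ m : Multiset ℂ, (∀ τ ∈ m, 0 ≤ (τ ^ 2).im) →
          0 ≤ ((m.map (fun τ => τ ^ 2)).sum).im := by
        intro m
        induction m using Multiset.induction with
        | empty => simp
        | cons a m ih =>
          intro h
          rw [Multiset.map_cons, Multiset.sum_cons, Complex.add_im]
          exact add_nonneg (h a (Multiset.mem_cons_self a m))
            (ih fun τ hτ => h τ (Multiset.mem_cons_of_mem hτ))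
      exact this m h2
    rw [hsum, h1] at h3
    linarith

lemma exists_form_real {n d : ℕ}
    (P : MvPolynomial (Fin n) ℝ) (e : Fin n → ℝ)
    (lm : (Fin n → ℝ) → Fin d → ℝ)
    (hhom : P.IsHomogeneous d)
    (hpe : MvPolynomial.eval e P ≠ 0)
    (hroots : ∀ (x : Fin n → ℝ) (t : ℝ),
      MvPolynomial.eval (x - t • e) P = MvPolynomial.eval e P * ∏ i, (lm x i - t)) :
    ∃ B : (Fin n → ℝ) →ₗ[ℝ] (Fin n → ℝ) →ₗ[ℝ] ℝ, (∀ x y, B x y = B y x) ∧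
      (∀ x, B x x = ∑ i, lm x i ^ 2) ∧
      (∀ x y, (∀ i, 0 ≤ lm x i) → (∀ i, 0 ≤ lm y i) → 0 ≤ B x y) := by
  set Q : MvPolynomial (Fin n) ℂ := MvPolynomial.map (algebraMap ℝ ℂ) P with hQdef
  have hQ : Q.IsHomogeneous d := hhom.map _
  have hcast : ∀ v : Fin n → ℝ, MvPolynomial.eval (cx v) Q = ((MvPolynomial.eval v P : ℝ) : ℂ) := by
    intro v
    rw [hQdef, MvPolynomial.eval_map]
    exact (MvPolynomial.eval₂_comp_left (algebraMap ℝ ℂ) (RingHom.id ℝ) v P).symm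
  have hconj : ∀ w : Fin n → ℂ, MvPolynomial.eval (fun i => (starRingEnd ℂ) (w i)) Q =
      (starRingEnd ℂ) (MvPolynomial.eval w Q) := by
    intro w
    rw [hQdef, MvPolynomial.eval_map, MvPolynomial.eval_map, MvPolynomial.eval₂_comp_left]
    congr 1
    ext r; simp
  set c : ℂ := ((MvPolynomial.eval e P : ℝ) : ℂ) with hcdef
  have hc : c ≠ 0 := by rw [hcdef]; exact_mod_cast hpe
  have h1 : ∀ (x : Fin n → ℝ) (a : ℂ),
      MvPolynomial.eval (cx x + a • cx e) Q = c * ∏ i, ((lm x i : ℂ) + a) := by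
    intro x a
    have hp : lineP Q (cx x) (cx e) = C c * ∏ i, (C (lm x i : ℂ) + X) := by
      apply Polynomial.eq_of_infinite_eval_eq
      refine Set.Infinite.mono ?_ (Set.infinite_range_of_injective Complex.ofReal_injective)
      rintro _ ⟨t, rfl⟩
      have := hroots x (-t)
      simp only [Set.mem_ofPred_eq, lineP_eval, eval_mul, eval_C, eval_prod, eval_add, eval_X]
      rw [← cx_smul, ← cx_add, hcast]
      rw [neg_smul, sub_neg_eq_add] at this
      rw [this]; push_cast; simp [hcdef]
    have := congrArg (eval a) hp
    simpa [lineP_eval, eval_prod] using this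
  have hr : ∀ (x : Fin n → ℝ) (a b : ℂ),
      MvPolynomial.eval (a • cx e + b • cx x) Q = c * ∏ i, (a + b * (lm x i : ℂ)) := by
    intro x a b
    by_cases hb : b = 0
    · subst hb
      simp only [zero_smul, add_zero, zero_mul, Finset.prod_const, Finset.card_univ,
        Fintype.card_fin]
      rw [hom_eval Q hQ, hcast, mul_comm]
    · have : a • cx e + b • cx x = b • (cx x + (b⁻¹ * a) • cx e) := by
        rw [smul_add, smul_smul, mul_inv_cancel_left₀ hb, add_comm]
      rw [this, hom_eval Q hQ, h1]
      have h2 : ∏ i, (a + b * (lm x i : ℂ)) = b ^ d * ∏ i, ((lm x i : ℂ) + b⁻¹ * a) := by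
        have : b ^ d = ∏ _i : Fin d, b := by simp
        rw [this, ← Finset.prod_mul_distrib]
        refine Finset.prod_congr rfl fun i _ => ?_
        field_simp; ring
      rw [h2]; ring
  obtain ⟨B, hs, hq, hpos⟩ := exists_form Q hQ e lm c hc hr hconj
  refine ⟨B, hs, hq, fun x y hx hy => ?_⟩
  have hshift : ∀ x : Fin n → ℝ, (∀ i, 0 ≤ lm x i) → ∀ ε : ℝ, 0 < ε → ∀ i, 0 < lm (x + ε • e) i := by
    intro x hx ε hε i
    have k1 := hroots (x + ε • e) (lm (x + ε • e) i)
    have k2 := hroots x (lm (x + ε • e) i - ε)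
    have k3 : x + ε • e - lm (x + ε • e) i • e = x - (lm (x + ε • e) i - ε) • e := by
      rw [sub_smul]; abel
    rw [k3, k2] at k1
    have k4 := mul_left_cancel₀ hpe k1
    rw [Finset.prod_eq_zero (Finset.mem_univ i) (f := fun j => lm (x + ε • e) j - lm (x + ε • e) i)
      (sub_self _)] at k4
    obtain ⟨j, -, hj⟩ := Finset.prod_eq_zero_iff.1 k4
    have := hx j
    linarith
  have hall : ∀ ε : ℝ, 0 < ε → 0 ≤ B x y + ε * (B x e + B e y) + ε ^ 2 * B e e := by
    intro ε hε
    have := hpos _ _ (hshift x hx ε hε) (hshift y hy ε hε)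
    simp only [map_add, map_smul, LinearMap.add_apply, LinearMap.smul_apply, smul_eq_mul] at this
    linarith
  have hcont : Continuous fun ε : ℝ => B x y + ε * (B x e + B e y) + ε ^ 2 * B e e := by fun_prop
  have ht : Filter.Tendsto (fun ε : ℝ => B x y + ε * (B x e + B e y) + ε ^ 2 * B e e)
      (nhdsWithin 0 (Set.Ioi 0)) (nhds (B x y)) := by
    have := (hcont.tendsto 0).mono_left (nhdsWithin_le_nhds (s := Set.Ioi 0))
    simpa using this
  exact ge_of_tendsto ht (by filter_upwards [self_mem_nhdsWithin] with ε hε using hall ε hε)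

lemma neg_sum {n d : ℕ}
    (P : MvPolynomial (Fin n) ℝ) (e : Fin n → ℝ)
    (lm : (Fin n → ℝ) → Fin d → ℝ)
    (hhom : P.IsHomogeneous d)
    (hpe : MvPolynomial.eval e P ≠ 0)
    (hroots : ∀ (x : Fin n → ℝ) (t : ℝ),
      MvPolynomial.eval (x - t • e) P = MvPolynomial.eval e P * ∏ i, (lm x i - t))
    (x : Fin n → ℝ) (φ : ℝ → ℝ) : ∑ i, φ (lm (-x) i) = ∑ i, φ (-lm x i) := by
  have key : ∀ t : ℝ, ∏ i, (t - lm (-x) i) = ∏ i, (t - (-lm x i)) := by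
    intro t
    have h1 := hroots (-x) t
    have h2 := hroots x (-t)
    have h3 : -x - t • e = (-1 : ℝ) • (x - (-t) • e) := by
      rw [neg_smul, neg_smul, one_smul]; abel
    rw [h3, hom_eval P hhom, h2] at h1
    have h4 : (-1 : ℝ) ^ d * ∏ i, (lm x i - -t) = ∏ i, (lm (-x) i - t) := by
      apply mul_left_cancel₀ hpe; rw [← h1]; ring
    have h5 : ∀ u : Fin d → ℝ, ∏ i, (t - u i) = (-1 : ℝ) ^ d * ∏ i, (u i - t) := by
      intro u
      have : (-1 : ℝ) ^ d = ∏ _i : Fin d, (-1 : ℝ) := by simp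
      rw [this, ← Finset.prod_mul_distrib]
      exact Finset.prod_congr rfl fun i _ => by ring
    rw [h5, ← h4, ← mul_assoc, ← mul_pow]
    simp only [mul_neg, mul_one, neg_neg, one_pow, one_mul]
    exact Finset.prod_congr rfl fun i _ => by ring
  have hpoly : (((Finset.univ.val.map (lm (-x))).map (fun a => X - C a)).prod : ℝ[X]) =
      ((Finset.univ.val.map (fun i => -lm x i)).map (fun a => X - C a)).prod := by
    apply Polynomial.funext
    intro t
    rw [Multiset.map_map, Multiset.map_map]
    change eval t (∏ i, (X - C (lm (-x) i))) = eval t (∏ i, (X - C (-lm x i)))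
    rw [eval_prod, eval_prod]
    simpa using key t
  have hms := congrArg roots hpoly
  rw [roots_multiset_prod_X_sub_C, roots_multiset_prod_X_sub_C] at hms
  have := congrArg (fun m => (m.map φ).sum) hms
  simp only [Multiset.map_map] at this
  exact this

lemma form_bound {n : ℕ} (B : (Fin n → ℝ) →ₗ[ℝ] (Fin n → ℝ) →ₗ[ℝ] ℝ) :
    ∃ K : ℝ, ∀ h, B h h ≤ K * ‖h‖ ^ 2 := by
  let L : (Fin n → ℝ) →L[ℝ] (Fin n → ℝ) →L[ℝ] ℝ :=
    LinearMap.toContinuousLinearMap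
      ((LinearMap.toContinuousLinearMap (𝕜 := ℝ) (E := Fin n → ℝ) (F' := ℝ)).toLinearMap ∘ₗ B)
  refine ⟨‖L‖, fun h => ?_⟩
  have := L.le_opNorm₂ h h
  have h2 : L h h = B h h := rfl
  rw [h2] at this
  calc B h h ≤ ‖B h h‖ := le_abs_self _
    _ ≤ ‖L‖ * ‖h‖ * ‖h‖ := this
    _ = _ := by ring


/-- Let `Λ = Λ(p,e)` with `p` complete, isometric and
`λ(ℝ^n) = ℝ^d↓`, and let `f(u) = (1/2) Σᵢ max(uᵢ,0)²`. Then `f ∘ λ` is convex and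
differentiable, and for every `x` the vector `y` representing the derivative of
`f ∘ λ` at `x` with respect to the inner product `⟨·,·⟩_p` (via polarization of
`‖z‖_p² = Σᵢ λᵢ(z)²`) is the projection of `x` onto `Λ` in the norm `‖·‖_p`. -/
theorem stmt_5 {n d : ℕ}
    (P : MvPolynomial (Fin n) ℝ) (e : Fin n → ℝ)
    (lm : (Fin n → ℝ) → Fin d → ℝ)
    (hhom : P.IsHomogeneous d)
    (hpe : MvPolynomial.eval e P ≠ 0)
    (hroots : ∀ (x : Fin n → ℝ) (t : ℝ),
      MvPolynomial.eval (x - t • e) P = MvPolynomial.eval e P * ∏ i, (lm x i - t))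
    (hord : ∀ x, Antitone (lm x))
    (hcomplete : ∀ x, lm x = 0 → x = 0)
    (hiso : ∀ y z : Fin n → ℝ, ∃ x, lm x = lm z ∧ lm (x + y) = lm x + lm y)
    (hrange : Set.range lm = {u : Fin d → ℝ | Antitone u}) :
    ConvexOn ℝ Set.univ (fun x : Fin n → ℝ => (1 / 2) * ∑ i, max (lm x i) 0 ^ 2) ∧
    Differentiable ℝ (fun x : Fin n → ℝ => (1 / 2) * ∑ i, max (lm x i) 0 ^ 2) ∧
    ∀ x : Fin n → ℝ, ∃ y : Fin n → ℝ,
      (∀ v : Fin n → ℝ,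
        fderiv ℝ (fun x : Fin n → ℝ => (1 / 2) * ∑ i, max (lm x i) 0 ^ 2) x v
          = ((∑ i, lm (y + v) i ^ 2) - ∑ i, lm (y - v) i ^ 2) / 4) ∧
      (∀ i, 0 ≤ lm y i) ∧
      ∀ z : Fin n → ℝ, (∀ i, 0 ≤ lm z i) →
        Real.sqrt (∑ i, lm (x - y) i ^ 2) ≤ Real.sqrt (∑ i, lm (x - z) i ^ 2) := by
  classical
  obtain ⟨B, hs, hq, hpos⟩ := exists_form_real P e lm hhom hpe hroots
  have hnn : ∀ x, 0 ≤ B x x := fun x => by rw [hq]; positivity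
  have hdef : ∀ x, B x x ≤ 0 → x = 0 := by
    intro x hx
    apply hcomplete
    rw [hq] at hx
    have h0 : ∑ i, lm x i ^ 2 = 0 := le_antisymm hx (by positivity)
    ext i
    have := (Finset.sum_eq_zero_iff_of_nonneg (fun i _ => sq_nonneg (lm x i))).1 h0 i
      (Finset.mem_univ i)
    simpa using this
  set F : (Fin n → ℝ) → ℝ := fun x => (1 / 2) * ∑ i, max (lm x i) 0 ^ 2 with hF
  -- positive part
  have hplus : ∀ x, ∃ y, (∀ i, 0 ≤ lm y i) ∧ B y y = ∑ i, max (lm x i) 0 ^ 2 ∧ B x y = B y y := by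
    intro x
    have hanti : Antitone (fun i => max (lm x i) 0) := fun i j hij =>
      max_le_max (hord x hij) le_rfl
    have : (fun i => max (lm x i) 0) ∈ Set.range lm := by rw [hrange]; exact hanti
    obtain ⟨z, hz⟩ := this
    obtain ⟨y, h1, h2⟩ := hiso x z
    rw [hz] at h1
    have h3 : ∀ i, lm y i = max (lm x i) 0 := fun i => congrFun h1 i
    have h4 : B y y = ∑ i, max (lm x i) 0 ^ 2 := by
      rw [hq]; exact Finset.sum_congr rfl fun i _ => by rw [h3]
    refine ⟨y, fun i => by rw [h3]; exact le_max_right _ _, h4, ?_⟩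
    have h5 : B (y + x) (y + x) = ∑ i, (max (lm x i) 0 ^ 2 + lm x i ^ 2 + 2 * max (lm x i) 0 ^ 2) := by
      rw [hq, h2]
      refine Finset.sum_congr rfl fun i _ => ?_
      rw [Pi.add_apply, h3]
      rcases le_total (lm x i) 0 with h | h
      · rw [max_eq_right h]; ring
      · rw [max_eq_left h]; ring
    rw [Finset.sum_add_distrib, Finset.sum_add_distrib, ← Finset.mul_sum, ← h4, ← hq x] at h5
    simp only [map_add, LinearMap.add_apply] at h5
    have := hs x y
    linarith
  -- Moreau decomposition
  have hdec : ∀ x, ∃ y w, (∀ i, 0 ≤ lm y i) ∧ (∀ i, 0 ≤ lm w i) ∧ x = y - w ∧ B y w = 0 ∧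
      F x = (1 / 2) * B y y := by
    intro x
    obtain ⟨y, y1, y2, y3⟩ := hplus x
    obtain ⟨w, w1, w2, w3⟩ := hplus (-x)
    rw [neg_sum P e lm hhom hpe hroots x (fun t => max t 0 ^ 2)] at w2
    have hxx : B x x = B y y + B w w := by
      rw [y2, w2, hq, ← Finset.sum_add_distrib]
      refine Finset.sum_congr rfl fun i _ => ?_
      rcases le_total (lm x i) 0 with h | h
      · rw [max_eq_right h, max_eq_left (by linarith)]; ring
      · rw [max_eq_left h, max_eq_right (by linarith)]; ring
    have hyw := hpos y w y1 w1
    have hexp : B (x - y + w) (x - y + w) = -2 * B y w := by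
      simp only [map_add, map_sub, map_neg, LinearMap.add_apply, LinearMap.sub_apply,
        LinearMap.neg_apply] at w3 ⊢
      have a1 := hs x y
      have a2 := hs x w
      have a3 := hs y w
      linarith
    have hz := hdef (x - y + w) (by rw [hexp]; linarith)
    refine ⟨y, w, y1, w1, ?_, ?_, ?_⟩
    · rw [← sub_eq_zero, ← hz]; abel
    · rw [hz] at hexp; simp at hexp; exact hexp
    · rw [hF, y2]
  have hlow : ∀ x y w x', (∀ i, 0 ≤ lm y i) → x = y - w → B y w = 0 → F x = (1 / 2) * B y y →
      F x + B y (x' - x) ≤ F x' := by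
    intro x y w x' hy hx hyw hFx
    obtain ⟨y', w', hy', hw', hx', hyw', hFx'⟩ := hdec x'
    rw [hFx, hFx', hx, hx']
    have b1 := hpos y w' hy hw'
    have b2 := hnn (y - y')
    simp only [map_sub, LinearMap.sub_apply] at b2 ⊢
    have a1 := hs y y'
    linarith
  have hup : ∀ x y w x', (∀ i, 0 ≤ lm w i) → x = y - w → B y w = 0 → F x = (1 / 2) * B y y →
      F x' ≤ F x + B y (x' - x) + (1 / 2) * B (x' - x) (x' - x) := by
    intro x y w x' hw hx hyw hFx
    obtain ⟨y', w', hy', hw', hx', hyw', hFx'⟩ := hdec x'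
    rw [hFx, hFx', hx, hx']
    have b1 := hpos y' w hy' hw
    have b2 := hnn (w - w')
    simp only [map_sub, LinearMap.sub_apply] at b2 ⊢
    have a1 := hs y y'
    have a2 := hs y w
    have a3 := hs y w'
    have a4 := hs y' w
    have a5 := hs y' w'
    have a6 := hs w w'
    linarith
  obtain ⟨K, hK⟩ := form_bound B
  have hder : ∀ x y w, (∀ i, 0 ≤ lm y i) → (∀ i, 0 ≤ lm w i) → x = y - w → B y w = 0 →
      F x = (1 / 2) * B y y → HasFDerivAt F (LinearMap.toContinuousLinearMap (B y)) x := by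
    intro x y w hy hw hx hyw hFx
    rw [hasFDerivAt_iff_isLittleO_nhds_zero]
    have hO : (fun h => F (x + h) - F x - (LinearMap.toContinuousLinearMap (B y)) h)
        =O[nhds 0] fun h => ‖h‖ ^ 2 := by
      refine Asymptotics.IsBigO.of_bound ((1 / 2) * K) (Filter.Eventually.of_forall fun h => ?_)
      have l := hlow x y w (x + h) hy hx hyw hFx
      have u := hup x y w (x + h) hw hx hyw hFx
      rw [add_sub_cancel_left] at l u
      have k := hK h
      have n1 : ‖‖h‖ ^ 2‖ = ‖h‖ ^ 2 := by simp
      rw [n1, Real.norm_eq_abs, abs_le]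
      simp only [LinearMap.coe_toContinuousLinearMap']
      have := hnn h
      constructor <;> linarith
    refine hO.trans_isLittleO ?_
    have h1 : (fun h : Fin n → ℝ => ‖h‖ ^ 2) =o[nhds 0] fun h : Fin n → ℝ => h := by
      exact Asymptotics.isLittleO_norm_pow_id (by norm_num)
    exact h1
  refine ⟨⟨convex_univ, fun x1 _ x2 _ a b ha hb hab => ?_⟩, fun x => ?_, fun x => ?_⟩
  · obtain ⟨y, w, hy, hw, hx, hyw, hFx⟩ := hdec (a • x1 + b • x2)
    have l1 := hlow _ y w x1 hy hx hyw hFx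
    have l2 := hlow _ y w x2 hy hx hyw hFx
    have l3 := add_le_add (mul_le_mul_of_nonneg_left l1 ha) (mul_le_mul_of_nonneg_left l2 hb)
    simp only [smul_eq_mul]
    refine le_trans (le_of_eq ?_) l3
    simp only [map_sub, map_add, map_smul, smul_eq_mul]
    obtain rfl : b = 1 - a := by linarith
    ring
  · obtain ⟨y, w, hy, hw, hx, hyw, hFx⟩ := hdec x
    exact (hder x y w hy hw hx hyw hFx).differentiableAt
  · obtain ⟨y, w, hy, hw, hx, hyw, hFx⟩ := hdec x
    refine ⟨y, fun v => ?_, hy, fun z hz => Real.sqrt_le_sqrt ?_⟩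
    · rw [(hder x y w hy hw hx hyw hFx).fderiv, ← hq, ← hq]
      simp only [LinearMap.coe_toContinuousLinearMap', map_add, map_sub, LinearMap.add_apply,
        LinearMap.sub_apply]
      have := hs y v
      linarith
    · rw [← hq, ← hq, hx]
      have b1 := hpos z w hz hw
      have b2 := hnn (y - z)
      have a1 := hs y w
      have a2 := hs z w
      have a3 := hs y z
      simp only [map_sub, LinearMap.sub_apply] at b2 ⊢
      linarith
end

section
/- Let Λ = Λ(p,e) be a hyperbolicity cone with p complete, isometric and λ(ℝ^n) = ℝ^d_↓, and let x ∈ ℝ^n be such that each eigenvalue λ_i(x) is a simple root of t ↦ p(x − t e). Then the projection of x onto Λ in the norm ‖·‖_p is P_Λ(x) = Σ_{i=1}^d max(λ_i(x), 0) · (1 / p^{(1)}(x − λ_i(x) e)) · ∇p(x − λ_i(x) e), where gradients are taken with respect to the inner product ⟨·,·⟩_p. -/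
open MvPolynomial in
noncomputable def hsub {n : ℕ} {K : Type*} [Field K] [Algebra ℝ K] (P : MvPolynomial (Fin n) ℝ)
    (a b : Fin n → K) : Polynomial K :=
  aeval (fun j => Polynomial.C (a j) + Polynomial.C (b j) * Polynomial.X) P

noncomputable def hdP {n : ℕ} {K : Type*} [Field K] [Algebra ℝ K] (P : MvPolynomial (Fin n) ℝ)
    (a v : Fin n → K) : K :=
  ∑ k, v k * MvPolynomial.aeval a (MvPolynomial.pderiv k P)

section
variable {n : ℕ} {K : Type*} [Field K] [Algebra ℝ K]

lemma hsub_eval (P : MvPolynomial (Fin n) ℝ) (a b : Fin n → K) (s : K) :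
    (hsub P a b).eval s = MvPolynomial.aeval (a + s • b) P := by
  unfold hsub
  induction P using MvPolynomial.induction_on with
  | C r => simp [Polynomial.algebraMap_apply]
  | add p q hp hq => simp [hp, hq]
  | mul_X p i hp => simp [hp, mul_comm s]

lemma hsub_deriv (P : MvPolynomial (Fin n) ℝ) (a b : Fin n → K) (s : K) :
    (Polynomial.derivative (hsub P a b)).eval s = hdP P (a + s • b) b := by
  have key : ∀ P : MvPolynomial (Fin n) ℝ, Polynomial.derivative (hsub P a b) =
      ∑ k, Polynomial.C (b k) * hsub (MvPolynomial.pderiv k P) a b := by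
    intro P
    unfold hsub
    induction P using MvPolynomial.induction_on with
    | C r => simp [Polynomial.algebraMap_apply]
    | add p q hp hq => simp [hp, hq, mul_add, Finset.sum_add_distrib]
    | mul_X p i hp =>
      set φ := MvPolynomial.aeval (R := ℝ)
        (fun j => Polynomial.C (a j) + Polynomial.C (b j) * Polynomial.X) with hφ
      have h1 : ∀ k, φ (MvPolynomial.pderiv k (p * MvPolynomial.X i)) =
          φ (MvPolynomial.pderiv k p) * (Polynomial.C (a i) + Polynomial.C (b i) * Polynomial.X)
          + φ p * (if i = k then 1 else 0) := by
        intro k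
        rw [MvPolynomial.pderiv_mul, map_add, map_mul, map_mul, MvPolynomial.pderiv_X,
          Pi.single_apply, hφ, MvPolynomial.aeval_X]
        split_ifs <;> simp
      have h2 : φ (MvPolynomial.X i) = Polynomial.C (a i) + Polynomial.C (b i) * Polynomial.X := by
        rw [hφ, MvPolynomial.aeval_X]
      have h3 : Polynomial.derivative (Polynomial.C (a i) + Polynomial.C (b i) * Polynomial.X)
          = Polynomial.C (b i) := by simp
      rw [map_mul, h2, Polynomial.derivative_mul, hp, h3, Finset.sum_mul]
      have h4 : ∑ k, Polynomial.C (b k) * (φ p * (if i = k then 1 else 0)) = φ p * Polynomial.C (b i) := by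
        rw [Finset.sum_eq_single i]
        · rw [if_pos rfl, mul_one, mul_comm]
        · intro k _ hk
          rw [if_neg (Ne.symm hk), mul_zero, mul_zero]
        · simp
      rw [← h4, ← Finset.sum_add_distrib]
      apply Finset.sum_congr rfl
      intro k _
      rw [h1, mul_add (Polynomial.C (b k)), mul_assoc]
  rw [key, hdP, Polynomial.eval_finsetSum]
  simp [hsub_eval]

lemma hsub_aux (P : MvPolynomial (Fin n) ℝ) {d : ℕ} (h : P.IsHomogeneous d) (a b : Fin n → K) :
    (hsub P a b).natDegree ≤ d ∧ (hsub P a b).coeff d = MvPolynomial.aeval b P := by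
  have hlin : ∀ j, (Polynomial.C (a j) + Polynomial.C (b j) * Polynomial.X).natDegree ≤ 1 := by
    intro j; compute_degree
  have hmon : ∀ m : Fin n →₀ ℕ, 
      (∏ i : Fin n, (Polynomial.C (a i) + Polynomial.C (b i) * Polynomial.X) ^ m i).natDegree
        ≤ ∑ i, m i ∧ 
      (∏ i : Fin n, (Polynomial.C (a i) + Polynomial.C (b i) * Polynomial.X) ^ m i).coeff (∑ i, m i)
        = ∏ i, b i ^ m i := by
    intro m
    have h1 : ∀ i, ((Polynomial.C (a i) + Polynomial.C (b i) * Polynomial.X) ^ m i).natDegree ≤ m i := by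
      intro i
      simpa using Polynomial.natDegree_pow_le_of_le (m i) (hlin i)
    have h2 : ∀ i, ((Polynomial.C (a i) + Polynomial.C (b i) * Polynomial.X) ^ m i).coeff (m i) = b i ^ m i := by
      intro i
      have := Polynomial.coeff_pow_of_natDegree_le (m := m i) (hlin i)
      simpa [Polynomial.coeff_C] using this
    have : ∀ s : Finset (Fin n), 
      (∏ i ∈ s, (Polynomial.C (a i) + Polynomial.C (b i) * Polynomial.X) ^ m i).natDegree
        ≤ ∑ i ∈ s, m i ∧ 
      (∏ i ∈ s, (Polynomial.C (a i) + Polynomial.C (b i) * Polynomial.X) ^ m i).coeff (∑ i ∈ s, m i)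
        = ∏ i ∈ s, b i ^ m i := by
      intro s
      induction s using Finset.induction_on with
      | empty => simp
      | insert i s hi ih =>
        simp only [Finset.prod_insert hi, Finset.sum_insert hi]
        refine ⟨Polynomial.natDegree_mul_le_of_le (h1 i) ih.1, ?_⟩
        rw [Polynomial.coeff_mul_add_eq_of_natDegree_le (h1 i) ih.1, h2, ih.2]
    exact this Finset.univ
  have hexp : ∀ m ∈ P.support, ∑ i, m i = d := by
    intro m hm
    have := h (MvPolynomial.mem_support_iff.mp hm)
    rw [← this]
    simp [Finsupp.weight_apply, Finsupp.sum_fintype]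
  unfold hsub
  rw [MvPolynomial.aeval_def, MvPolynomial.eval₂_eq', MvPolynomial.aeval_def, MvPolynomial.eval₂_eq']
  constructor
  · apply Polynomial.natDegree_sum_le_of_forall_le
    intro m hm
    rw [Polynomial.algebraMap_apply]
    refine (Polynomial.natDegree_C_mul_le _ _).trans ?_
    rw [← hexp m hm]
    exact (hmon m).1
  · rw [Polynomial.finsetSum_coeff]
    apply Finset.sum_congr rfl
    intro m hm
    rw [Polynomial.algebraMap_apply, Polynomial.coeff_C_mul]
    congr 1
    have := (hmon m).2
    rw [hexp m hm] at this
    exact this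

lemma h_smul (P : MvPolynomial (Fin n) ℝ) {d : ℕ} (h : P.IsHomogeneous d) (c : K) (a : Fin n → K) :
    MvPolynomial.aeval (c • a) P = c ^ d * MvPolynomial.aeval a P := by
  rw [MvPolynomial.aeval_def, MvPolynomial.eval₂_eq', MvPolynomial.aeval_def, MvPolynomial.eval₂_eq',
    Finset.mul_sum]
  apply Finset.sum_congr rfl
  intro m hm
  have hexp : ∑ i, m i = d := by
    have := h (MvPolynomial.mem_support_iff.mp hm)
    rw [← this]
    simp [Finsupp.weight_apply, Finsupp.sum_fintype]
  simp only [Pi.smul_apply, smul_eq_mul, mul_pow, Finset.prod_mul_distrib, Finset.prod_pow_eq_pow_sum, hexp]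
  ring

lemma hdP_add (P : MvPolynomial (Fin n) ℝ) (a v w : Fin n → K) :
    hdP P a (v + w) = hdP P a v + hdP P a w := by
  simp [hdP, add_mul, Finset.sum_add_distrib]

lemma hdP_smul (P : MvPolynomial (Fin n) ℝ) (a v : Fin n → K) (c : K) :
    hdP P a (c • v) = c * hdP P a v := by
  simp [hdP, Finset.mul_sum, mul_assoc]

lemma hdP_euler (P : MvPolynomial (Fin n) ℝ) {d : ℕ} (h : P.IsHomogeneous d) (a : Fin n → K) :
    hdP P a a = d * MvPolynomial.aeval a P := by
  have := congrArg (MvPolynomial.aeval a) h.sum_X_mul_pderiv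
  simpa [hdP] using this

lemma hdP_homog (P : MvPolynomial (Fin n) ℝ) {d : ℕ} (h : P.IsHomogeneous d) (c : K) (a v : Fin n → K) :
    hdP P (c • a) v = c ^ (d - 1) * hdP P a v := by
  simp only [hdP, Finset.mul_sum]
  apply Finset.sum_congr rfl
  intro k _
  rw [h_smul _ h.pderiv]; ring

end

lemma h_fderiv {n : ℕ} (P : MvPolynomial (Fin n) ℝ) (a v : Fin n → ℝ) :
    DifferentiableAt ℝ (fun z : Fin n → ℝ => MvPolynomial.eval z P) a ∧
    fderiv ℝ (fun z : Fin n → ℝ => MvPolynomial.eval z P) a v = hdP P a v := by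
  have hd : DifferentiableAt ℝ (fun z : Fin n → ℝ => MvPolynomial.eval z P) a :=
    (AnalyticOnNhd.eval_mvPolynomial P a (Set.mem_univ _)).differentiableAt
  refine ⟨hd, ?_⟩
  have h1 : HasDerivAt (fun s : ℝ => a + s • v) v 0 := by
    simpa using ((hasDerivAt_id (0:ℝ)).smul_const v).const_add a
  have h2 : HasFDerivAt (fun z : Fin n → ℝ => MvPolynomial.eval z P)
    (fderiv ℝ (fun z : Fin n → ℝ => MvPolynomial.eval z P) a) (a + (0:ℝ) • v) := by
    simpa using hd.hasFDerivAt
  have h3 := h2.comp_hasDerivAt (0:ℝ) h1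
  have h4 := (hsub P a v).hasDerivAt 0
  rw [hsub_deriv] at h4
  have : (fun s => (hsub P a v).eval s) = 
    (fun z : Fin n → ℝ => MvPolynomial.eval z P) ∘ (fun s : ℝ => a + s • v) := by
    funext s
    rw [hsub_eval]; simp [MvPolynomial.aeval_eq_eval]
  rw [this] at h4
  simpa using h3.unique h4

lemma h_prod_deriv {d : ℕ} (α β : Fin d → ℝ) (τ : ℝ) :
    HasDerivAt (fun τ : ℝ => ∏ j, (α j + τ * β j))
      (∑ i, β i * ∏ j ∈ Finset.univ.erase i, (α j + τ * β j)) τ := by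
  have : ∀ i ∈ (Finset.univ : Finset (Fin d)), HasDerivAt (fun τ : ℝ => α i + τ * β i) (β i) τ := by
    intro i _
    simpa using ((hasDerivAt_id τ).mul_const (β i)).const_add (α i)
  have h := HasDerivAt.fun_finsetProd this
  have h2 : (∑ i, (∏ j ∈ Finset.univ.erase i, (α j + τ * β j)) • β i)
    = ∑ i, β i * ∏ j ∈ Finset.univ.erase i, (α j + τ * β j) := by
    apply Finset.sum_congr rfl
    intro i _
    simp [mul_comm]
  rw [← h2]
  exact h

lemma h_line_deriv {n : ℕ} (P : MvPolynomial (Fin n) ℝ) (a b : Fin n → ℝ) (τ : ℝ) :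
    HasDerivAt (fun τ : ℝ => MvPolynomial.aeval (a + τ • b) P) (hdP P (a + τ • b) b) τ := by
  have h4 := (hsub P a b).hasDerivAt τ
  rw [hsub_deriv] at h4
  simpa only [hsub_eval] using h4

noncomputable def hH {n : ℕ} (P : MvPolynomial (Fin n) ℝ) (e v w : Fin n → ℝ) : ℝ :=
  ∑ k, v k * hdP (MvPolynomial.pderiv k P) e w

lemma hH_symm {n : ℕ} (P : MvPolynomial (Fin n) ℝ) (e v w : Fin n → ℝ) :
    hH P e v w = hH P e w v := by
  have hc : ∀ i j : Fin n, MvPolynomial.pderiv i (MvPolynomial.pderiv j P)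
      = MvPolynomial.pderiv j (MvPolynomial.pderiv i P) := by
    intro i j
    have : ⁅(MvPolynomial.pderiv i : Derivation ℝ (MvPolynomial (Fin n) ℝ) (MvPolynomial (Fin n) ℝ)),
      (MvPolynomial.pderiv j : Derivation ℝ (MvPolynomial (Fin n) ℝ) (MvPolynomial (Fin n) ℝ))⁆ = 0 := by
      apply MvPolynomial.derivation_ext
      intro k
      simp only [Derivation.commutator_apply, MvPolynomial.pderiv_X, Pi.single_apply]
      split_ifs <;> simp
    have h2 := congrArg (fun D => D P) this
    simpa [Derivation.commutator_apply, sub_eq_zero] using h2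
  unfold hH hdP
  simp only [Finset.mul_sum]
  rw [Finset.sum_comm]
  apply Finset.sum_congr rfl; intro i _
  apply Finset.sum_congr rfl; intro j _
  rw [hc]; ring

lemma hH_line {n : ℕ} (P : MvPolynomial (Fin n) ℝ) (e v w : Fin n → ℝ) :
    HasDerivAt (fun τ : ℝ => hdP P (e + τ • w) v) (hH P e v w) 0 := by
  unfold hH
  have : ∀ k ∈ (Finset.univ : Finset (Fin n)), HasDerivAt
     (fun τ : ℝ => v k * MvPolynomial.aeval (e + τ • w) (MvPolynomial.pderiv k P))
     (v k * hdP (MvPolynomial.pderiv k P) e w) 0 := by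
    intro k _
    have := (h_line_deriv (MvPolynomial.pderiv k P) e w 0).const_mul (v k)
    simpa using this
  exact HasDerivAt.fun_sum this

lemma h_second {n d : ℕ} (P : MvPolynomial (Fin n) ℝ) (e v w : Fin n → ℝ) (p : ℝ) (a b : Fin d → ℝ)
    (h : ∀ τ : ℝ, hdP P (e + τ • w) v = p * ∑ i, a i * ∏ j ∈ Finset.univ.erase i, (1 + τ * b j)) :
    hdP P e v = p * ∑ i, a i ∧ hH P e v w = p * ((∑ i, a i) * (∑ i, b i) - ∑ i, a i * b i) := by
  constructor
  · simpa using h 0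
  · have h1 := hH_line P e v w
    have h2 : HasDerivAt (fun τ : ℝ => p * ∑ i, a i * ∏ j ∈ Finset.univ.erase i, (1 + τ * b j))
       (p * ∑ i, a i * ∑ j ∈ Finset.univ.erase i, b j) 0 := by
      apply HasDerivAt.const_mul
      apply HasDerivAt.fun_sum
      intro i _
      apply HasDerivAt.const_mul
      have : ∀ j ∈ Finset.univ.erase i, HasDerivAt (fun τ : ℝ => 1 + τ * b j) (b j) 0 := by
        intro j _
        simpa using ((hasDerivAt_id (0:ℝ)).mul_const (b j)).const_add 1
      have h := HasDerivAt.fun_finsetProd this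
      simpa using h
    rw [funext h] at h1
    rw [h1.unique h2, Finset.sum_mul, ← Finset.sum_sub_distrib]
    congr 1
    apply Finset.sum_congr rfl; intro i _
    rw [← Finset.add_sum_erase _ b (Finset.mem_univ i)]; ring

noncomputable def hB {n : ℕ} (P : MvPolynomial (Fin n) ℝ) (e v w : Fin n → ℝ) : ℝ :=
  hdP P e v * hdP P e w / (MvPolynomial.aeval e P) ^ 2 - hH P e v w / MvPolynomial.aeval e P

lemma hB_of {n d : ℕ} (P : MvPolynomial (Fin n) ℝ) (e v w : Fin n → ℝ) 
    (hp : MvPolynomial.aeval e P ≠ (0:ℝ)) (a b : Fin d → ℝ)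
    (h : ∀ τ : ℝ, hdP P (e + τ • w) v =
      MvPolynomial.aeval e P * ∑ i, a i * ∏ j ∈ Finset.univ.erase i, (1 + τ * b j))
    (hw : hdP P e w = MvPolynomial.aeval e P * ∑ i, b i) :
    hB P e v w = ∑ i, a i * b i := by
  obtain ⟨h1, h2⟩ := h_second P e v w _ a b h
  rw [hB, h1, h2, hw]
  field_simp
  ring

section
variable {n d : ℕ}
    (P : MvPolynomial (Fin n) ℝ) (e : Fin n → ℝ)
    (lm : (Fin n → ℝ) → Fin d → ℝ)
    (hhom : P.IsHomogeneous d)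
    (hpe : MvPolynomial.aeval e P ≠ (0:ℝ))
    (hroots : ∀ (x : Fin n → ℝ) (t : ℝ),
      MvPolynomial.aeval (x - t • e) P = MvPolynomial.aeval e P * ∏ i, (lm x i - t))
include hhom hpe hroots

omit hpe in
lemma h_rev (w : Fin n → ℝ) (τ : ℝ) :
    MvPolynomial.aeval (e + τ • w) P = MvPolynomial.aeval e P * ∏ i, (1 + τ * lm w i) := by
  by_cases h : τ = 0
  · simp [h]
  · have : e + τ • w = τ • (w - (-τ⁻¹) • e) := by
      rw [smul_sub, smul_smul]; field_simp; simp [add_comm]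
    rw [this, h_smul P hhom, hroots]
    have : τ ^ d = ∏ i : Fin d, τ := by simp
    rw [this, mul_left_comm, ← Finset.prod_mul_distrib]
    congr 1
    apply Finset.prod_congr rfl; intro i _
    field_simp; ring

omit hpe in
lemma h_rev1 (w : Fin n → ℝ) (τ : ℝ) :
    hdP P (e + τ • w) w = MvPolynomial.aeval e P *
      ∑ i, lm w i * ∏ j ∈ Finset.univ.erase i, (1 + τ * lm w j) := by
  have h1 := h_line_deriv P e w τ
  rw [funext (h_rev P e lm hhom hroots w)] at h1
  exact h1.unique ((h_prod_deriv (fun _ => 1) (lm w) τ).const_mul _)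

lemma hB_self (w : Fin n → ℝ) : hB P e w w = ∑ i, lm w i ^ 2 := by
  have h := h_rev1 P e lm hhom hroots w
  rw [hB_of P e w w hpe _ _ h]
  · simp [sq]
  · simpa using h 0

lemma h_De (x : Fin n → ℝ) (i : Fin d) :
    hdP P (x - lm x i • e) e = MvPolynomial.aeval e P * 
      ∏ j ∈ Finset.univ.erase i, (lm x j - lm x i) := by
  have h1 := h_line_deriv P x (-e) (lm x i)
  have h3 : ∀ t : ℝ, MvPolynomial.aeval (x + t • (-e)) P =
     MvPolynomial.aeval e P * ∏ j, (lm x j + t * (-1)) := by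
    intro t
    rw [smul_neg, ← sub_eq_add_neg, hroots]; simp [sub_eq_add_neg]
  rw [funext h3] at h1
  have h2 := h1.unique ((h_prod_deriv (lm x) (fun _ => -1) (lm x i)).const_mul _)
  have h4 : hdP P (x + lm x i • (-e)) (-e) = - hdP P (x - lm x i • e) e := by
    rw [smul_neg, ← sub_eq_add_neg]; simp [hdP]
  rw [h4, Finset.sum_eq_single i] at h2
  · simp only [mul_neg, mul_one, neg_mul, one_mul, ← sub_eq_add_neg, neg_inj] at h2
    exact h2
  · intro k _ hk
    rw [Finset.prod_eq_zero (i := i)]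
    · simp
    · simp [Ne.symm hk]
    · simp
  · simp

lemma h_De_ne (x : Fin n → ℝ) (hx : StrictAnti (lm x)) (i : Fin d) :
    hdP P (x - lm x i • e) e ≠ 0 := by
  rw [h_De P e lm hhom hpe hroots]
  refine mul_ne_zero hpe (Finset.prod_ne_zero_iff.2 ?_)
  intro j hj
  rw [sub_ne_zero]
  exact fun h => (Finset.ne_of_mem_erase hj) (hx.injective h)

lemma h_lagrange (x : Fin n → ℝ) (hx : StrictAnti (lm x)) (v : Fin n → ℝ) (δ : Fin d → ℝ)
    (hδ : ∀ i, hdP P (x - lm x i • e) v = δ i * hdP P (x - lm x i • e) e) (t : ℝ) :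
    hdP P (x - t • e) v = MvPolynomial.aeval e P *
      ∑ i, δ i * ∏ j ∈ Finset.univ.erase i, (lm x j - t) := by
  rcases Nat.eq_zero_or_pos d with rfl | hd
  · have : ∀ k, MvPolynomial.pderiv k P = 0 := by
      intro k
      have : P.totalDegree = 0 := by simpa using hhom.totalDegree_le
      rw [MvPolynomial.totalDegree_eq_zero_iff_eq_C.1 this, MvPolynomial.pderiv_C]
    simp [hdP, this]
  let f : Polynomial ℝ := ∑ k, Polynomial.C (v k) * hsub (MvPolynomial.pderiv k P) x (-e)
  let g : Polynomial ℝ := Polynomial.C (MvPolynomial.aeval e P) *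
    ∑ i, Polynomial.C (δ i) * ∏ j ∈ Finset.univ.erase i, (Polynomial.C (lm x j) - Polynomial.X)
  have hf : ∀ t, f.eval t = hdP P (x - t • e) v := by
    intro t
    simp [f, Polynomial.eval_finsetSum, hsub_eval, hdP, ← sub_eq_add_neg]
  have hg : ∀ t, g.eval t = MvPolynomial.aeval e P *
      ∑ i, δ i * ∏ j ∈ Finset.univ.erase i, (lm x j - t) := by
    intro t
    simp [g, Polynomial.eval_finsetSum, Polynomial.eval_prod]
  have hfd : f.natDegree ≤ d - 1 := by
    apply Polynomial.natDegree_sum_le_of_forall_le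
    intro k _
    exact (Polynomial.natDegree_C_mul_le _ _).trans (hsub_aux _ hhom.pderiv _ _).1
  have hgd : g.natDegree ≤ d - 1 := by
    refine (Polynomial.natDegree_C_mul_le _ _).trans ?_
    apply Polynomial.natDegree_sum_le_of_forall_le
    intro i _
    refine (Polynomial.natDegree_C_mul_le _ _).trans ?_
    refine (Polynomial.natDegree_prod_le _ _).trans ?_
    refine (Finset.sum_le_card_nsmul _ _ 1 ?_).trans ?_
    · intro j _; compute_degree
    · simp
  have hlt : ∀ q : Polynomial ℝ, q.natDegree ≤ d - 1 → q.degree < (Finset.univ : Finset (Fin d)).card := by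
    intro q hq
    refine lt_of_le_of_lt Polynomial.degree_le_natDegree ?_
    simp only [Finset.card_univ, Fintype.card_fin]
    exact_mod_cast (by omega : q.natDegree < d)
  have hfg : f = g := by
    refine Polynomial.eq_of_degrees_lt_of_eval_index_eq Finset.univ (v := lm x) hx.injective.injOn 
      (hlt f hfd) (hlt g hgd) ?_
    intro i _
    rw [hf, hg, hδ, h_De P e lm hhom hpe hroots, Finset.sum_eq_single i]
    · ring
    · intro k _ hk
      rw [Finset.prod_eq_zero (i := i)]
      · simp
      · simp [Ne.symm hk]
      · simp
    · simp
  rw [← hf, hfg, hg]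

lemma hB_x (x : Fin n → ℝ) (hx : StrictAnti (lm x)) (v : Fin n → ℝ) (δ : Fin d → ℝ)
    (hδ : ∀ i, hdP P (x - lm x i • e) v = δ i * hdP P (x - lm x i • e) e) :
    hB P e v x = ∑ i, δ i * lm x i := by
  apply hB_of P e v x hpe
  · have h1 : Continuous (fun τ : ℝ => hdP P (e + τ • x) v) := by
      unfold hdP
      refine continuous_finsetSum _ fun k _ => continuous_const.mul ?_
      exact continuous_iff_continuousAt.2 fun τ => (h_line_deriv _ e x τ).continuousAt
    have h2 : Continuous (fun τ : ℝ => MvPolynomial.aeval e P *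
      ∑ i, δ i * ∏ j ∈ Finset.univ.erase i, (1 + τ * lm x j)) := by fun_prop
    have := Continuous.ext_on (dense_compl_singleton (0:ℝ)) h1 h2 ?_
    · exact fun τ => congrFun this τ
    intro τ hτ
    have hτ : τ ≠ 0 := hτ
    have : e + τ • x = τ • (x - (-τ⁻¹) • e) := by
      rw [smul_sub, smul_smul]; field_simp; simp [add_comm]
    simp only
    rw [this, hdP_homog P hhom, h_lagrange P e lm hhom hpe hroots x hx v δ hδ, mul_left_comm,
      Finset.mul_sum]
    congr 1
    apply Finset.sum_congr rfl; intro i _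
    have : τ ^ (d-1) = ∏ j ∈ Finset.univ.erase i, τ := by simp
    rw [this, mul_left_comm, ← Finset.prod_mul_distrib]
    congr 1
    apply Finset.prod_congr rfl; intro i _
    field_simp; ring
  · simpa using h_rev1 P e lm hhom hroots x 0
end

open Filter Topology

def hcv {n : ℕ} (x : Fin n → ℝ) : Fin n → ℂ := fun j => (x j : ℂ)

lemma hcv_aeval {n : ℕ} (P : MvPolynomial (Fin n) ℝ) (x : Fin n → ℝ) :
    MvPolynomial.aeval (hcv x) P = ((MvPolynomial.aeval x P : ℝ) : ℂ) := by
  have := MvPolynomial.aeval_algebraMap_apply (A := ℝ) ℂ x P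
  exact this

lemma hcv_hdP {n : ℕ} (P : MvPolynomial (Fin n) ℝ) (x v : Fin n → ℝ) :
    hdP P (hcv x) (hcv v) = ((hdP P x v : ℝ) : ℂ) := by
  simp only [hdP, hcv_aeval]
  simp [hcv]

lemma h_cont {n : ℕ} (P : MvPolynomial (Fin n) ℝ) :
    Continuous (fun u : Fin n → ℂ => MvPolynomial.aeval u P) := by
  induction P using MvPolynomial.induction_on with
  | C r => simpa using continuous_const
  | add p q hp hq => simp only [map_add]; exact hp.add hq
  | mul_X p i hp => simp only [map_mul, MvPolynomial.aeval_X]; exact hp.mul (continuous_apply i)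

section
variable {n d : ℕ}
    (P : MvPolynomial (Fin n) ℝ) (e : Fin n → ℝ)
    (lm : (Fin n → ℝ) → Fin d → ℝ)
    (hhom : P.IsHomogeneous d)
    (hpe : MvPolynomial.aeval e P ≠ (0:ℝ))
    (hroots : ∀ (x : Fin n → ℝ) (t : ℝ),
      MvPolynomial.aeval (x - t • e) P = MvPolynomial.aeval e P * ∏ i, (lm x i - t))

include hroots in
lemma h_cx (x : Fin n → ℝ) (t : ℂ) :
    MvPolynomial.aeval (hcv x - t • hcv e) P =
      ((MvPolynomial.aeval e P : ℝ) : ℂ) * ∏ i, ((lm x i : ℂ) - t) := by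
  have key : hsub P (hcv x) (- hcv e) = Polynomial.C ((MvPolynomial.aeval e P : ℝ) : ℂ) *
      ∏ i, (Polynomial.C (lm x i : ℂ) - Polynomial.X) := by
    apply Polynomial.eq_of_infinite_eval_eq
    apply Set.Infinite.mono (s := Set.range (fun r : ℝ => (r : ℂ)))
    · rintro _ ⟨r, rfl⟩
      have h1 : hcv x + (r : ℂ) • -hcv e = hcv (x - r • e) := by
        funext j; simp [hcv, sub_eq_add_neg]
      simp only [Set.mem_ofPred_eq, hsub_eval, h1, hcv_aeval, hroots]
      simp [Polynomial.eval_prod]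
    · exact Set.infinite_range_of_injective Complex.ofReal_injective
  have := congrArg (Polynomial.eval t) key
  simpa [hsub_eval, Polynomial.eval_prod, ← sub_eq_add_neg] using this

include hroots hpe in
lemma h_cx_ne (x : Fin n → ℝ) (t : ℂ) (ht : t.im ≠ 0) :
    MvPolynomial.aeval (hcv x - t • hcv e) P ≠ 0 := by
  rw [h_cx P e lm hroots]
  refine mul_ne_zero (by exact_mod_cast hpe) (Finset.prod_ne_zero_iff.2 ?_)
  intro i _ h
  apply ht
  rw [sub_eq_zero] at h
  rw [← h]; simp

include hroots hpe hhom in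
lemma h_stable (x z : Fin n → ℝ) (hz : ∀ j, 0 < lm z j) (t : ℂ) (ht : 0 < t.im) (s : ℂ)
    (hs : MvPolynomial.aeval ((hcv x - t • hcv e) + s • hcv z) P = 0) : 0 < s.im := by
  have hfz : MvPolynomial.aeval (hcv z) P ≠ 0 := by
    have := h_cx P e lm hroots z 0
    rw [zero_smul, sub_zero] at this
    rw [this]
    refine mul_ne_zero (by exact_mod_cast hpe) (Finset.prod_ne_zero_iff.2 ?_)
    intro i _
    simpa using (hz i).ne'
  obtain ⟨F, hFd⟩ : ∃ F : ℝ → ℂ → ℂ, ∀ θ s, F θ s =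
      MvPolynomial.aeval (((θ : ℂ) • hcv x - t • hcv e) + s • hcv z) P := ⟨_, fun _ _ => rfl⟩
  have hF : Continuous (fun q : ℝ × ℂ => F q.1 q.2) := by
    simp only [hFd]
    apply (h_cont P).comp
    fun_prop
  have hreal : ∀ θ s, F θ s = 0 → s.im ≠ 0 := by
    intro θ s h hs
    have h1 : ((θ : ℂ) • hcv x - t • hcv e) + s • hcv z = hcv (θ • x + s.re • z) - t • hcv e := by
      funext j
      have : s = (s.re : ℂ) := by apply Complex.ext <;> simp [hs]
      rw [this]
      simp [hcv]; ring
    refine h_cx_ne P e lm hpe hroots (θ • x + s.re • z) t ht.ne' ?_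
    rw [← h1, ← hFd]; exact h
  let A : Set ℝ := {θ | ∃ s, s.im ≤ 0 ∧ F θ s = 0}
  have h0 : (0:ℝ) ∉ A := by
    rintro ⟨s, hs1, hs2⟩
    have hs0 : s ≠ 0 := by
      rintro rfl
      exact hreal 0 0 hs2 rfl
    have h1 : (((0:ℝ) : ℂ) • hcv x - t • hcv e) + s • hcv z = s • (hcv z - (t / s) • hcv e) := by
      rw [smul_sub, smul_smul, mul_div_cancel₀ _ hs0]; simp; abel
    have h2 : MvPolynomial.aeval (s • (hcv z - (t / s) • hcv e)) P = 0 := by rw [← h1, ← hFd]; exact hs2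
    rw [h_smul P hhom, h_cx P e lm hroots] at h2
    rcases mul_eq_zero.1 h2 with h2 | h2
    · exact (pow_ne_zero d hs0) h2
    rcases mul_eq_zero.1 h2 with h2 | h2
    · exact hpe (by exact_mod_cast h2)
    obtain ⟨i, _, hi⟩ := Finset.prod_eq_zero_iff.1 h2
    have h3 : t = (lm z i : ℂ) * s := by
      rw [sub_eq_zero] at hi
      rw [hi, div_mul_cancel₀ _ hs0]
    rw [h3] at ht
    simp at ht
    nlinarith [hz i]
  have hclosed : IsClosed A := by
    rw [← isSeqClosed_iff_isClosed]
    intro θ θ0 hθ hlim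
    choose σ hσ1 hσ2 using hθ
    -- bounded
    have hb1 : Bornology.IsBounded (Set.range (fun k => (((θ k : ℝ) : ℂ) • hcv x - t • hcv e))) := by
      apply Metric.isBounded_range_of_tendsto (x := (((θ0 : ℝ) : ℂ) • hcv x - t • hcv e))
      have : Continuous (fun r : ℝ => ((r : ℂ) • hcv x - t • hcv e)) := by fun_prop
      exact (this.tendsto θ0).comp hlim
    obtain ⟨M, hM⟩ := hb1.exists_norm_le
    have hne : ∀ᶠ u in 𝓝 (hcv z), MvPolynomial.aeval u P ≠ 0 :=
      (h_cont P).continuousAt.eventually_ne hfz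
    obtain ⟨ε, hε, hball⟩ := Metric.eventually_nhds_iff.1 hne
    have hbd : ∀ k, σ k ∈ Metric.closedBall (0:ℂ) (M / ε) := by
      intro k
      rw [mem_closedBall_zero_iff]
      by_contra hcon
      push Not at hcon
      have hM0 : 0 ≤ M := (norm_nonneg _).trans (hM _ ⟨k, rfl⟩)
      have hpos : 0 < ‖σ k‖ := lt_of_le_of_lt (by positivity) hcon
      have hk0 : σ k ≠ 0 := norm_pos_iff.1 hpos
      have h1 : (((θ k : ℝ) : ℂ) • hcv x - t • hcv e) + σ k • hcv z 
        = σ k • (hcv z + (σ k)⁻¹ • (((θ k : ℝ) : ℂ) • hcv x - t • hcv e)) := by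
        rw [smul_add, smul_smul, mul_inv_cancel₀ hk0, one_smul, add_comm]
      have h2 := hσ2 k
      rw [hFd] at h2
      rw [h1, h_smul P hhom] at h2
      rcases mul_eq_zero.1 h2 with h2 | h2
      · exact (pow_ne_zero d hk0) h2
      · refine hball ?_ h2
        rw [dist_eq_norm, add_sub_cancel_left, norm_smul, norm_inv]
        rw [div_lt_iff₀ hε] at hcon
        rw [inv_mul_lt_iff₀ hpos]
        exact lt_of_le_of_lt (hM _ ⟨k, rfl⟩) hcon
    obtain ⟨s0, _, φ, hφ, hs0⟩ := (isCompact_closedBall (0:ℂ) (M/ε)).tendsto_subseq hbd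
    refine ⟨s0, ?_, ?_⟩
    · exact le_of_tendsto ((Complex.continuous_im.tendsto s0).comp hs0) 
        (Eventually.of_forall fun k => hσ1 (φ k))
    · have h3 : Tendsto (fun k => (θ (φ k), σ (φ k))) atTop (𝓝 (θ0, s0)) :=
        (hlim.comp hφ.tendsto_atTop).prodMk_nhds hs0
      have h1 : Tendsto (fun k => F (θ (φ k)) (σ (φ k))) atTop (𝓝 (F θ0 s0)) :=
        Tendsto.comp (g := fun q : ℝ × ℂ => F q.1 q.2) (hF.tendsto (θ0, s0)) h3
      refine tendsto_nhds_unique h1 ?_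
      simp only [hσ2]
      exact tendsto_const_nhds
  have hopen : IsOpen A := by
    rw [isOpen_iff_mem_nhds]
    rintro θ0 ⟨s0, hs1, hs2⟩
    have him : s0.im < 0 := lt_of_le_of_ne hs1 (hreal θ0 s0 hs2)
    set η := -s0.im with hη
    have hηp : 0 < η := by linarith
    have hc : Continuous (fun θ : ℝ => ‖F θ s0‖) := by
      have : Continuous (fun θ : ℝ => F θ s0) := hF.comp (by fun_prop : Continuous fun θ : ℝ => (θ, s0))
      exact this.norm
    have hlt : ∀ᶠ θ in 𝓝 θ0, ‖F θ s0‖ < ‖MvPolynomial.aeval (hcv z) P‖ * η ^ d := by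
      apply (hc.tendsto θ0).eventually_lt_const
      rw [hs2, norm_zero]
      have := norm_pos_iff.2 hfz
      positivity
    filter_upwards [hlt] with θ hθ
    let G := hsub P ((θ : ℂ) • hcv x - t • hcv e) (hcv z)
    obtain ⟨hG1, hG2⟩ := hsub_aux P hhom ((θ : ℂ) • hcv x - t • hcv e) (hcv z)
    have hGd : G.natDegree = d := 
      le_antisymm hG1 (Polynomial.le_natDegree_of_ne_zero (by rw [hG2]; exact hfz))
    have hGl : G.leadingCoeff = MvPolynomial.aeval (hcv z) P := by
      rw [Polynomial.leadingCoeff, hGd]; exact hG2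
    have hGs : G.Splits := IsAlgClosed.splits G
    have hGe : ∀ s, G.eval s = F θ s := fun s => by rw [hFd]; exact hsub_eval _ _ _ _
    have hG0 : G ≠ 0 := by
      intro h; rw [h] at hGl; simp at hGl; exact hfz hGl.symm
    by_contra hcon
    have hall : ∀ r ∈ G.roots, η ≤ ‖s0 - r‖ := by
      intro r hr
      by_contra hlt'
      push Not at hlt'
      apply hcon
      refine ⟨r, ?_, ?_⟩
      · have := (Complex.abs_im_le_norm (s0 - r)).trans_lt hlt'
        rw [Complex.sub_im, abs_lt] at this
        linarith [this.1]
      · rw [← hGe]; exact (Polynomial.mem_roots hG0).1 hr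
    have hprod : ∀ m : Multiset ℂ, (∀ r ∈ m, η ≤ ‖s0 - r‖) → 
        η ^ (m.card) ≤ ‖(m.map (fun r => s0 - r)).prod‖ := by
      intro m
      induction m using Multiset.induction_on with
      | empty => simp
      | cons a m ih =>
        intro h
        rw [Multiset.card_cons, Multiset.map_cons, Multiset.prod_cons, norm_mul, pow_succ']
        exact mul_le_mul (h a (by simp)) (ih fun r hr => h r (by simp [hr])) (by positivity) (norm_nonneg _)
    have h1 := hprod _ hall
    have hcard : G.roots.card = d := by rw [← hGs.natDegree_eq_card_roots, hGd]
    rw [← hGe, hGs.eval_eq_prod_roots, hGl, norm_mul] at hθ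
    rw [hcard] at h1
    have := norm_pos_iff.2 hfz
    nlinarith
  have hA : A = ∅ := by
    rcases isClopen_iff.1 ⟨hclosed, hopen⟩ with h | h
    · exact h
    · exact absurd (h ▸ Set.mem_univ (0:ℝ)) h0
  by_contra hcon
  push Not at hcon
  have : (1:ℝ) ∈ A := ⟨s, hcon, by rw [hFd, Complex.ofReal_one, one_smul]; exact hs⟩
  rw [hA] at this
  exact this

include hroots hpe hhom in
lemma h_herglotz (x z : Fin n → ℝ) (hz : ∀ j, 0 < lm z j) (t : ℂ) (ht : 0 < t.im) :
    0 ≤ (hdP P (hcv x - t • hcv e) (hcv z) / MvPolynomial.aeval (hcv x - t • hcv e) P).im := by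
  let G := hsub P (hcv x - t • hcv e) (hcv z)
  have hG0 : G.eval 0 = MvPolynomial.aeval (hcv x - t • hcv e) P := by
    simp [G, hsub_eval]
  have hG1 : G.derivative.eval 0 = hdP P (hcv x - t • hcv e) (hcv z) := by
    simp [G, hsub_deriv]
  have hne : G.eval 0 ≠ 0 := by rw [hG0]; exact h_cx_ne P e lm hpe hroots x t ht.ne'
  have hGs : G.Splits := IsAlgClosed.splits G
  have hGn : G ≠ 0 := by rintro h; rw [h] at hne; simp at hne
  rw [← hG0, ← hG1, hGs.eval_derivative_div_eval_of_ne_zero hne]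
  have : ∀ r ∈ G.roots, 0 < r.im := by
    intro r hr
    apply h_stable P e lm hhom hpe hroots x z hz t ht r
    rw [← hsub_eval]; exact (Polynomial.mem_roots hGn).1 hr
  generalize G.roots = m at this
  induction m using Multiset.induction_on with
  | empty => simp
  | cons a m ih =>
    rw [Multiset.map_cons, Multiset.sum_cons, Complex.add_im]
    refine add_nonneg ?_ (ih fun r hr => this r (by simp [hr]))
    have h := this a (by simp)
    rw [zero_sub, one_div, Complex.inv_im, Complex.neg_im, neg_neg, Complex.normSq_neg]
    exact div_nonneg h.le (Complex.normSq_nonneg a)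

include hroots hpe hhom in
lemma h_mono_strict (x : Fin n → ℝ) (hx : StrictAnti (lm x)) (z : Fin n → ℝ) (hz : ∀ j, 0 < lm z j)
    (i : Fin d) : 0 ≤ hdP P (x - lm x i • e) z / hdP P (x - lm x i • e) e := by
  let T : ℝ → ℂ := fun η => (lm x i : ℂ) + η * Complex.I
  let D : ℝ → ℂ := fun η => ((MvPolynomial.aeval e P : ℝ) : ℂ) * 
    ∏ j ∈ Finset.univ.erase i, ((lm x j : ℂ) - T η)
  let h : ℝ → ℂ := fun η => Complex.I * hdP P (hcv x - T η • hcv e) (hcv z) / D η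
  have hT : Continuous T := by fun_prop
  have hD : Continuous D := by fun_prop
  have hN : Continuous (fun η => Complex.I * hdP P (hcv x - T η • hcv e) (hcv z)) := by
    unfold hdP
    refine continuous_const.mul (continuous_finsetSum _ fun k _ => continuous_const.mul ?_)
    exact (h_cont _).comp (by fun_prop)
  have hD0 : D 0 = ((hdP P (x - lm x i • e) e : ℝ) : ℂ) := by
    rw [h_De P e lm hhom hpe hroots]
    simp [D, T]
  have hN0 : hdP P (hcv x - T 0 • hcv e) (hcv z) = ((hdP P (x - lm x i • e) z : ℝ) : ℂ) := by
    rw [← hcv_hdP]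
    congr 1
    funext j; simp [hcv, T]
  have hDne : D 0 ≠ 0 := by
    rw [hD0]; exact_mod_cast h_De_ne P e lm hhom hpe hroots x hx i
  have hc : ContinuousAt (fun η => (h η).im) 0 := 
    Complex.continuous_im.continuousAt.comp (hN.continuousAt.div hD.continuousAt hDne)
  have hpos : ∀ η : ℝ, 0 < η → 0 ≤ (h η).im := by
    intro η hη
    have h1 := h_herglotz P e lm hhom hpe hroots x z hz (T η) (by simpa [T] using hη)
    have h2 : MvPolynomial.aeval (hcv x - T η • hcv e) P = (-(η * Complex.I)) * D η := by
      rw [h_cx P e lm hroots, ← Finset.mul_prod_erase _ _ (Finset.mem_univ i)]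
      simp only [D]
      have : (lm x i : ℂ) - T η = -(η * Complex.I) := by simp [T]
      rw [this]; ring
    have h3 : h η = (η : ℂ) * (hdP P (hcv x - T η • hcv e) (hcv z) / 
        MvPolynomial.aeval (hcv x - T η • hcv e) P) := by
      rw [h2]
      simp only [h]
      have hη' : (η : ℂ) ≠ 0 := by exact_mod_cast hη.ne'
      by_cases hd0 : D η = 0
      · simp [hd0]
      field_simp
      rw [Complex.I_sq]; ring
    rw [h3, Complex.im_ofReal_mul]
    exact mul_nonneg hη.le h1
  have hlim : 0 ≤ (h 0).im := by
    have h1 : Tendsto (fun η => (h η).im) (𝓝[>] 0) (𝓝 (h 0).im) := hc.tendsto.mono_left nhdsWithin_le_nhds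
    refine ge_of_tendsto h1 ?_
    filter_upwards [self_mem_nhdsWithin] with η hη using hpos η hη
  have h4 : h 0 = Complex.I * ((hdP P (x - lm x i • e) z / hdP P (x - lm x i • e) e : ℝ) : ℂ) := by
    simp only [h]
    rw [hN0, hD0]; push_cast; ring
  rw [h4] at hlim
  simpa using hlim

include hroots hpe hhom in
lemma h_mono (x : Fin n → ℝ) (hx : StrictAnti (lm x)) (z : Fin n → ℝ) (hz : ∀ j, 0 ≤ lm z j)
    (i : Fin d) : 0 ≤ hdP P (x - lm x i • e) z / hdP P (x - lm x i • e) e := by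
  apply le_of_forall_pos_le_add
  intro ε hε
  have hz' : ∀ j, 0 < lm (z + ε • e) j := by
    intro j
    have h1 := hroots (z + ε • e) (lm (z + ε • e) j)
    rw [Finset.prod_eq_zero (Finset.mem_univ j) (sub_self _), mul_zero] at h1
    have h2 : z + ε • e - lm (z + ε • e) j • e = z - (lm (z + ε • e) j - ε) • e := by
      rw [sub_smul]; abel
    rw [h2, hroots] at h1
    obtain ⟨k, _, hk⟩ := Finset.prod_eq_zero_iff.1 ((mul_eq_zero.1 h1).resolve_left hpe)
    linarith [hz k]
  have := h_mono_strict P e lm hhom hpe hroots x hx _ hz' i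
  rw [hdP_add, hdP_smul, add_div, mul_div_assoc, 
    div_self (h_De_ne P e lm hhom hpe hroots x hx i), mul_one] at this
  exact this
end


lemma h_uniq {d : ℕ} (a b : Fin d → ℝ) (ha : Antitone a) (hb : Antitone b)
    (h : ∀ t : ℝ, ∏ i, (a i - t) = ∏ i, (b i - t)) : a = b := by
  have hp : (∏ i, (Polynomial.X - Polynomial.C (a i)) : Polynomial ℝ)
      = ∏ i, (Polynomial.X - Polynomial.C (b i)) := by
    apply Polynomial.funext
    intro t
    simp only [Polynomial.eval_prod, Polynomial.eval_sub, Polynomial.eval_X, Polynomial.eval_C]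
    have e1 : ∀ c : Fin d → ℝ, ∏ i, (t - c i) = (-1) ^ d * ∏ i, (c i - t) := by
      intro c
      rw [← Fin.prod_const d (-1 : ℝ), ← Finset.prod_mul_distrib]
      apply Finset.prod_congr rfl; intro i _; ring
    rw [e1, e1, h]
  have hr : ∀ c : Fin d → ℝ, (∏ i, (Polynomial.X - Polynomial.C (c i)) : Polynomial ℝ).roots
      = ((List.ofFn c : List ℝ) : Multiset ℝ) := by
    intro c
    have : (∏ i, (Polynomial.X - Polynomial.C (c i)) : Polynomial ℝ)
      = (Multiset.map (fun r => Polynomial.X - Polynomial.C r) ((List.ofFn c : List ℝ) : Multiset ℝ)).prod := by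
      simp [List.map_ofFn, List.prod_ofFn]
    rw [this, Polynomial.roots_multiset_prod_X_sub_C]
  have h2 : ((List.ofFn a : List ℝ) : Multiset ℝ) = ((List.ofFn b : List ℝ) : Multiset ℝ) := by
    rw [← hr, ← hr, hp]
  have h3 : (List.ofFn a).Perm (List.ofFn b) := Multiset.coe_eq_coe.1 h2
  exact List.ofFn_injective (h3.eq_of_sortedGE ha.sortedGE_ofFn hb.sortedGE_ofFn)

noncomputable def hBl {n : ℕ} (P : MvPolynomial (Fin n) ℝ) (e : Fin n → ℝ) :
    (Fin n → ℝ) →ₗ[ℝ] (Fin n → ℝ) →ₗ[ℝ] ℝ :=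
  LinearMap.mk₂ ℝ (hB P e)
    (by intro a b c
        have : hH P e (a + b) c = hH P e a c + hH P e b c := by
          simp [hH, add_mul, Finset.sum_add_distrib]
        simp only [hB, hdP_add, this]; ring)
    (by intro s a c
        have : hH P e (s • a) c = s * hH P e a c := by
          simp [hH, mul_assoc, Finset.mul_sum]
        simp only [hB, hdP_smul, this, smul_eq_mul]; ring)
    (by intro c a b
        have : hH P e c (a + b) = hH P e c a + hH P e c b := by
          simp [hH, hdP_add, mul_add, Finset.sum_add_distrib]
        simp only [hB, hdP_add, this]; ring)
    (by intro s c a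
        have : hH P e c (s • a) = s * hH P e c a := by
          simp only [hH, hdP_smul, Finset.mul_sum]
          apply Finset.sum_congr rfl; intro i _; ring
        simp only [hB, hdP_smul, this, smul_eq_mul]; ring)

lemma hBl_symm {n : ℕ} (P : MvPolynomial (Fin n) ℝ) (e v w : Fin n → ℝ) :
    hBl P e v w = hBl P e w v := by
  change hB P e v w = hB P e w v
  unfold hB; rw [hH_symm]; ring

lemma hBl_bound {n : ℕ} (B : (Fin n → ℝ) →ₗ[ℝ] (Fin n → ℝ) →ₗ[ℝ] ℝ)
    (h0 : ∀ w, 0 ≤ B w w) (hd : ∀ w, B w w = 0 → w = 0) :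
    ∃ c : ℝ, 0 < c ∧ ∀ w, c * ‖w‖ ^ 2 ≤ B w w := by
  have hcont : Continuous (fun w => B w w) := by
    have : ∀ w, B w w = ∑ i, w i * B (fun j => if i = j then 1 else 0) w := by
      intro w
      have := LinearMap.pi_apply_eq_sum_univ (B.flip w) w
      simpa only [LinearMap.flip_apply, smul_eq_mul] using this
    simp only [this]
    apply continuous_finsetSum
    intro i _
    exact (continuous_apply i).mul (B _).continuous_of_finiteDimensional
  by_cases hne : (Metric.sphere (0 : Fin n → ℝ) 1).Nonempty
  · obtain ⟨m, hm, hmin⟩ := (isCompact_sphere (0 : Fin n → ℝ) 1).exists_isMinOn hne hcont.continuousOn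
    have hmn : ‖m‖ = 1 := by simpa using hm
    refine ⟨B m m, ?_, ?_⟩
    · rcases (h0 m).lt_or_eq with h | h
      · exact h
      · have := hd m h.symm
        rw [this] at hmn; simp at hmn
    · intro w
      by_cases hw : w = 0
      · simp [hw]
      have hw' : 0 < ‖w‖ := norm_pos_iff.2 hw
      have h1 : (‖w‖⁻¹ • w) ∈ Metric.sphere (0 : Fin n → ℝ) 1 := by
        simp [norm_smul, hw'.ne']
      have h2 : B m m ≤ B (‖w‖⁻¹ • w) (‖w‖⁻¹ • w) := hmin h1
      simp only [map_smul, LinearMap.smul_apply, smul_eq_mul] at h2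
      calc B m m * ‖w‖ ^ 2 ≤ (‖w‖⁻¹ * (‖w‖⁻¹ * B w w)) * ‖w‖ ^ 2 := by gcongr
        _ = B w w := by field_simp
  · refine ⟨1, one_pos, ?_⟩
    intro w
    by_cases hw : w = 0
    · simp [hw]
    have hw' : 0 < ‖w‖ := norm_pos_iff.2 hw
    exact absurd ⟨‖w‖⁻¹ • w, by simp [norm_smul, hw'.ne']⟩ hne

open Filter Topology

lemma h_L5 {n d : ℕ}
    (P : MvPolynomial (Fin n) ℝ) (e : Fin n → ℝ)
    (lm : (Fin n → ℝ) → Fin d → ℝ)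
    (hhom : P.IsHomogeneous d)
    (hpe : MvPolynomial.aeval e P ≠ (0:ℝ))
    (hroots : ∀ (x : Fin n → ℝ) (t : ℝ),
      MvPolynomial.aeval (x - t • e) P = MvPolynomial.aeval e P * ∏ i, (lm x i - t))
    (hord : ∀ x, Antitone (lm x))
    (hcomplete : ∀ x, lm x = 0 → x = 0)
    (hiso : ∀ y z : Fin n → ℝ, ∃ x, lm x = lm z ∧ lm (x + y) = lm x + lm y)
    (hrange : Set.range lm = {u : Fin d → ℝ | Antitone u})
    (x : Fin n → ℝ) (u : Fin d → ℝ) (hu : Antitone u) :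
    ∃ v, lm v = u ∧ ∀ i, hdP P (x - lm x i • e) v = u i * hdP P (x - lm x i • e) e := by
  have hself : ∀ w, hBl P e w w = ∑ i, lm w i ^ 2 := fun w => hB_self P e lm hhom hpe hroots w
  obtain ⟨c, hc, hcb⟩ := hBl_bound (hBl P e)
    (by intro w; rw [hself]; positivity)
    (by intro w hw
        rw [hself, Finset.sum_eq_zero_iff_of_nonneg (fun i _ => sq_nonneg _)] at hw
        apply hcomplete; ext i; simpa using hw i (Finset.mem_univ i))
  have hex : ∀ k : ℕ, ∃ v : Fin n → ℝ, lm v = ((k:ℝ)+1)⁻¹ • u ∧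
      lm (x + v) = ((k:ℝ)+1)⁻¹ • u + lm x := by
    intro k
    have hk : (0:ℝ) ≤ ((k:ℝ)+1)⁻¹ := by positivity
    have : ((k:ℝ)+1)⁻¹ • u ∈ Set.range lm := by
      rw [hrange]
      intro i j hij
      exact mul_le_mul_of_nonneg_left (hu hij) hk
    obtain ⟨z, hz⟩ := this
    obtain ⟨v, h1, h2⟩ := hiso x z
    refine ⟨v, by rw [h1, hz], ?_⟩
    rw [add_comm x v, h2, h1, hz]
  choose v' hv1 hv2 using hex
  have hkne : ∀ k : ℕ, (k:ℝ) + 1 ≠ 0 := fun k => by positivity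
  let w : ℕ → Fin n → ℝ := fun k => ((k:ℝ)+1) • v' k
  have hQ : ∀ k, hBl P e (w k) (w k) = ∑ i, u i ^ 2 := by
    intro k
    simp only [w, map_smul, LinearMap.smul_apply, smul_eq_mul, hself, hv1, Finset.mul_sum, Pi.smul_apply]
    apply Finset.sum_congr rfl; intro i _
    have := hkne k
    field_simp
  have hbd : ∀ k, w k ∈ Metric.closedBall (0 : Fin n → ℝ) (Real.sqrt ((∑ i, u i ^ 2) / c)) := by
    intro k
    rw [mem_closedBall_zero_iff]
    apply Real.le_sqrt_of_sq_le
    rw [le_div_iff₀ hc, mul_comm, ← hQ k]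
    exact hcb _
  obtain ⟨v, _, φ, hφ, hlim⟩ := (isCompact_closedBall (0 : Fin n → ℝ) _).tendsto_subseq hbd
  have hinv : Tendsto (fun k => (((φ k : ℕ):ℝ)+1)⁻¹) atTop (𝓝 0) := by
    have := (tendsto_one_div_add_atTop_nhds_zero_nat (𝕜 := ℝ)).comp hφ.tendsto_atTop
    simpa [Function.comp_def] using this
  have hwv : ∀ k, v' k = ((k:ℝ)+1)⁻¹ • w k := by
    intro k; simp only [w]; rw [smul_smul, inv_mul_cancel₀ (hkne k), one_smul]
  refine ⟨v, ?_, ?_⟩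
  · apply h_uniq _ _ (hord v) hu
    intro t
    have hval : ∀ k, MvPolynomial.aeval (w k - t • e) P
        = MvPolynomial.aeval e P * ∏ i, (u i - t) := by
      intro k
      have e1 : w k - t • e = ((k:ℝ)+1) • (v' k - (t * ((k:ℝ)+1)⁻¹) • e) := by
        rw [smul_sub, smul_smul, mul_comm t, ← mul_assoc, mul_inv_cancel₀ (hkne k), one_mul]
      rw [e1, h_smul P hhom, hroots, hv1]
      rw [← Fin.prod_const d, mul_left_comm, ← Finset.prod_mul_distrib]
      congr 1
      apply Finset.prod_congr rfl; intro i _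
      have := hkne k
      simp only [Pi.smul_apply, smul_eq_mul]
      field_simp
    have hct : Continuous (fun z : Fin n → ℝ => MvPolynomial.aeval (z - t • e) P) := by
      have := (MvPolynomial.continuous_eval P).comp (continuous_id.sub (continuous_const (y := t • e)))
      simpa [Function.comp_def, MvPolynomial.aeval_eq_eval] using this
    have h1 := (hct.tendsto v).comp hlim
    have h2 : Tendsto ((fun z : Fin n → ℝ => MvPolynomial.aeval (z - t • e) P) ∘ w ∘ φ) atTop
        (𝓝 (MvPolynomial.aeval e P * ∏ i, (u i - t))) := by
      simp only [Function.comp_def, hval]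
      exact tendsto_const_nhds
    have h3 := tendsto_nhds_unique h1 h2
    simp only [hroots] at h3
    exact mul_left_cancel₀ hpe h3
  · intro i
    obtain ⟨hd1, hd2⟩ := h_fderiv P (x - lm x i • e) (v - u i • e)
    have hcd : Tendsto (fun k => (((φ k : ℕ):ℝ)+1) • (v' (φ k) - ((((φ k : ℕ):ℝ)+1)⁻¹ * u i) • e)) atTop
        (𝓝 (v - u i • e)) := by
      have : ∀ k, (((φ k : ℕ):ℝ)+1) • (v' (φ k) - ((((φ k : ℕ):ℝ)+1)⁻¹ * u i) • e)
          = w (φ k) - u i • e := by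
        intro k
        rw [smul_sub, smul_smul, ← mul_assoc, mul_inv_cancel₀ (hkne _), one_mul]
      simp only [this]
      exact hlim.sub tendsto_const_nhds
    have hd0 : Tendsto (fun k => (v' (φ k) - ((((φ k : ℕ):ℝ)+1)⁻¹ * u i) • e)) atTop (𝓝 0) := by
      have := hinv.smul hcd
      rw [zero_smul] at this
      refine this.congr ?_
      intro k
      rw [smul_smul, inv_mul_cancel₀ (hkne _), one_smul]
    have h1 := (hasFDerivWithinAt_univ.2 hd1.hasFDerivAt).lim hd0 (by simp) hcd
    have hz : ∀ k, MvPolynomial.eval (x - lm x i • e + (v' k - (((k:ℝ)+1)⁻¹ * u i) • e)) P = 0 := by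
      intro k
      have e1 : x - lm x i • e + (v' k - (((k:ℝ)+1)⁻¹ * u i) • e)
        = (x + v' k) - (((k:ℝ)+1)⁻¹ * u i + lm x i) • e := by
        rw [add_smul]; abel
      rw [e1]
      have := hroots (x + v' k) (((k:ℝ)+1)⁻¹ * u i + lm x i)
      rw [MvPolynomial.aeval_eq_eval] at this
      refine this.trans ?_
      rw [Finset.prod_eq_zero (Finset.mem_univ i), mul_zero]
      rw [hv2]; simp
    have hz0 : MvPolynomial.eval (x - lm x i • e) P = 0 := by
      have := hroots x (lm x i)
      rw [MvPolynomial.aeval_eq_eval] at this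
      refine this.trans ?_
      rw [Finset.prod_eq_zero (Finset.mem_univ i), mul_zero]
      simp
    simp only [hz, hz0, sub_zero, smul_zero] at h1
    have h2 := tendsto_nhds_unique h1 tendsto_const_nhds
    rw [hd2] at h2
    have h3 : v = (v - u i • e) + u i • e := by simp
    rw [h3, hdP_add, h2, hdP_smul, zero_add]

open Filter Topology

lemma h_linalg {n d : ℕ} (B : (Fin n → ℝ) →ₗ[ℝ] (Fin n → ℝ) →ₗ[ℝ] ℝ)
    (lm : (Fin n → ℝ) → Fin d → ℝ)
    (hs : ∀ v w, B v w = B w v)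
    (h0 : ∀ w, 0 ≤ B w w) (hd : ∀ w, B w w = 0 → w = 0)
    (x : Fin n → ℝ) (μ : Fin d → ℝ) (hμ : StrictAnti μ) (c : Fin d → Fin n → ℝ)
    (hx : ∀ v, B v x = ∑ i, B (c i) v * μ i)
    (hcx : ∀ i, B (c i) x = μ i)
    (hle : ∀ i, B (c i) (c i) ≤ 1)
    (hL : ∀ u : Fin d → ℝ, Antitone u → ∃ v, lm v = u ∧ B v v = ∑ i, u i ^ 2 ∧ ∀ i, B (c i) v = u i) :
    x = ∑ i, μ i • c i ∧ (∀ u : Fin d → ℝ, Antitone u → lm (∑ i, u i • c i) = u) ∧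
    (∀ i j, B (c i) (c j) = if i = j then 1 else 0) := by
  have hSl : ∀ (u : Fin d → ℝ) v, B (∑ i, u i • c i) v = ∑ i, u i * B (c i) v := by
    intro u v; simp [map_sum, LinearMap.sum_apply]
  have hd1 : ∀ (u : Fin d → ℝ) v, B v v = ∑ i, u i ^ 2 → (∀ i, B (c i) v = u i) →
      B ((∑ i, u i • c i) - v) ((∑ i, u i • c i) - v)
        = B (∑ i, u i • c i) (∑ i, u i • c i) - ∑ i, u i ^ 2 := by
    intro u v hv hc
    have e1 : B (∑ i, u i • c i) v = ∑ i, u i ^ 2 := by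
      rw [hSl]; apply Finset.sum_congr rfl; intro i _; rw [hc]; ring
    simp only [map_sub, LinearMap.sub_apply, hs v (∑ i, u i • c i), e1, hv]; ring
  have hq : ∀ h : Fin d → ℝ, ∑ i, h i ^ 2 ≤ B (∑ i, h i • c i) (∑ i, h i • c i) := by
    intro h
    have hev : ∀ᶠ ε in 𝓝[>] (0:ℝ), ∀ i j, i < j → μ j + ε * h j < μ i + ε * h i := by
      apply eventually_all.2; intro i
      apply eventually_all.2; intro j
      by_cases hij : i < j
      · have hc1 : Continuous (fun ε : ℝ => μ j + ε * h j) := by fun_prop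
        have hc2 : Continuous (fun ε : ℝ => μ i + ε * h i) := by fun_prop
        have := (hc1.tendsto 0).eventually_lt (hc2.tendsto 0) (by simpa using hμ hij)
        filter_upwards [mem_nhdsWithin_of_mem_nhds this] with ε hε _ using hε
      · simp [hij]
    obtain ⟨ε, hε, hpos⟩ := (hev.and self_mem_nhdsWithin).exists
    have hpos : 0 < ε := hpos
    have hanti : Antitone (μ + ε • h) := by
      intro i j hij
      rcases hij.lt_or_eq with hl | rfl
      · exact (hε i j hl).le
      · exact le_rfl
    obtain ⟨v, -, hv, hc⟩ := hL _ hanti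
    have h1 := hd1 _ v hv hc
    have h2 := h0 ((∑ i, (μ + ε • h) i • c i) - v)
    have hS : ∑ i, (μ + ε • h) i • c i = ∑ i, μ i • c i + ε • ∑ i, h i • c i := by
      simp [add_smul, Finset.sum_add_distrib, Finset.smul_sum, smul_smul]
    have hxx : x = ∑ i, μ i • c i := by
      rw [← sub_eq_zero]; apply hd
      have : ∀ v, B (x - ∑ i, μ i • c i) v = 0 := by
        intro v
        rw [map_sub, LinearMap.sub_apply, hSl, hs, hx, sub_eq_zero]
        apply Finset.sum_congr rfl; intro i _; ring
      exact this _
    have e1 : B x x = ∑ i, μ i ^ 2 := by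
      rw [hx]; apply Finset.sum_congr rfl; intro i _; rw [hcx]; ring
    have e2 : B (∑ i, h i • c i) x = ∑ i, h i * μ i := by
      rw [hSl]; simp only [hcx]
    have e3 : ∑ i, (μ + ε • h) i ^ 2 = ∑ i, μ i ^ 2 + 2 * ε * ∑ i, h i * μ i + ε ^ 2 * ∑ i, h i ^ 2 := by
      rw [Finset.mul_sum, Finset.mul_sum, ← Finset.sum_add_distrib, ← Finset.sum_add_distrib]
      apply Finset.sum_congr rfl; intro i _
      simp only [Pi.add_apply, Pi.smul_apply, smul_eq_mul]; ring
    rw [h1, e3, hS, ← hxx] at h2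
    simp only [map_add, LinearMap.add_apply, map_smul, LinearMap.smul_apply, smul_eq_mul,
      hs x, e1, e2] at h2
    have h4 : 0 ≤ ε ^ 2 * (B (∑ i, h i • c i) (∑ i, h i • c i) - ∑ i, h i ^ 2) := by linarith
    have := nonneg_of_mul_nonneg_right h4 (by positivity)
    linarith
  have hone : ∀ i, B (c i) (c i) = 1 := by
    intro i
    have := hq (Pi.single i 1)
    simp [Pi.single_apply] at this
    linarith [hle i]
  have horth : ∀ i j, B (c i) (c j) = if i = j then 1 else 0 := by
    intro i j
    split_ifs with hij
    · subst hij; exact hone i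
    have key : ∀ s : ℝ, 0 ≤ 2 * s * B (c i) (c j) := by
      intro s
      have h1 := hq (Pi.single i 1 + Pi.single j s)
      have e1 : ∑ k, ((Pi.single i 1 + Pi.single j s : Fin d → ℝ) k) • c k = c i + s • c j := by
        simp [add_smul, Finset.sum_add_distrib, Pi.single_apply, ite_smul]
      have e2 : ∑ k, ((Pi.single i 1 + Pi.single j s : Fin d → ℝ) k) ^ 2 = 1 + s ^ 2 := by
        have : ∀ k, ((Pi.single i 1 + Pi.single j s : Fin d → ℝ) k) ^ 2
          = (if k = i then 1 else 0) + (if k = j then s ^ 2 else 0) := by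
          intro k
          simp only [Pi.add_apply, Pi.single_apply]
          split_ifs with a b
          · exact absurd (a.symm.trans b) hij
          all_goals simp
        rw [Finset.sum_congr rfl (fun k _ => this k)]
        simp [Finset.sum_add_distrib]
      rw [e1, e2] at h1
      simp only [map_add, LinearMap.add_apply, map_smul, LinearMap.smul_apply, smul_eq_mul, hone,
        hs (c j) (c i)] at h1
      linarith
    linarith [key 1, key (-1)]
  have hall : ∀ u : Fin d → ℝ, B (∑ i, u i • c i) (∑ i, u i • c i) = ∑ i, u i ^ 2 := by
    intro u
    rw [hSl]
    apply Finset.sum_congr rfl; intro i _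
    rw [hs, hSl]
    simp [horth, pow_two]
  have hlm : ∀ u : Fin d → ℝ, Antitone u → lm (∑ i, u i • c i) = u := by
    intro u hu
    obtain ⟨v, hlv, hv, hc⟩ := hL u hu
    have := hd1 u v hv hc
    rw [hall, sub_self] at this
    rw [sub_eq_zero.1 (hd _ this), hlv]
  refine ⟨?_, hlm, horth⟩
  rw [← sub_eq_zero]; apply hd
  have : ∀ v, B (x - ∑ i, μ i • c i) v = 0 := by
    intro v
    rw [map_sub, LinearMap.sub_apply, hSl, hs, hx, sub_eq_zero]
    apply Finset.sum_congr rfl; intro i _; ring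
  exact this _

/-- Under the assumptions of Statement 5, if moreover every eigenvalue
of `x` is a simple root of `t ↦ p(x - t e)` (i.e. `lm x` is strictly decreasing), then
the projection of `x` onto `Λ` in `‖·‖_p` equals
`Σᵢ max(λᵢ(x),0) (1 / p⁽¹⁾(x - λᵢ(x) e)) ∇p(x - λᵢ(x) e)`, where `g i` is the gradient
of `p` at `x - λᵢ(x) e` with respect to `⟨·,·⟩_p` and `p⁽¹⁾(z) = D_e p(z)`. -/
theorem stmt_6 {n d : ℕ}
    (P : MvPolynomial (Fin n) ℝ) (e : Fin n → ℝ)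
    (lm : (Fin n → ℝ) → Fin d → ℝ)
    (hhom : P.IsHomogeneous d)
    (hpe : MvPolynomial.eval e P ≠ 0)
    (hroots : ∀ (x : Fin n → ℝ) (t : ℝ),
      MvPolynomial.eval (x - t • e) P = MvPolynomial.eval e P * ∏ i, (lm x i - t))
    (hord : ∀ x, Antitone (lm x))
    (hcomplete : ∀ x, lm x = 0 → x = 0)
    (hiso : ∀ y z : Fin n → ℝ, ∃ x, lm x = lm z ∧ lm (x + y) = lm x + lm y)
    (hrange : Set.range lm = {u : Fin d → ℝ | Antitone u})
    (x : Fin n → ℝ)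
    (hsimple : StrictAnti (lm x))
    (g : Fin d → Fin n → ℝ)
    (hg : ∀ (i : Fin d) (v : Fin n → ℝ),
      fderiv ℝ (fun z : Fin n → ℝ => MvPolynomial.eval z P) (x - lm x i • e) v
        = ((∑ j, lm (g i + v) j ^ 2) - ∑ j, lm (g i - v) j ^ 2) / 4) :
    ∀ y : Fin n → ℝ,
      y = ∑ i, (max (lm x i) 0 /
          fderiv ℝ (fun z : Fin n → ℝ => MvPolynomial.eval z P) (x - lm x i • e) e) • g i →
      (∀ j, 0 ≤ lm y j) ∧
      ∀ z : Fin n → ℝ, (∀ j, 0 ≤ lm z j) →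
        Real.sqrt (∑ j, lm (x - y) j ^ 2) ≤ Real.sqrt (∑ j, lm (x - z) j ^ 2) := by
  intro y hy
  have hpe' : MvPolynomial.aeval e P ≠ (0:ℝ) := by rw [MvPolynomial.aeval_eq_eval]; exact hpe
  have hroots' : ∀ (x : Fin n → ℝ) (t : ℝ),
      MvPolynomial.aeval (x - t • e) P = MvPolynomial.aeval e P * ∏ i, (lm x i - t) := by
    intro x t; rw [MvPolynomial.aeval_eq_eval, MvPolynomial.aeval_eq_eval]; exact hroots x t
  have hself : ∀ w, hBl P e w w = ∑ i, lm w i ^ 2 := fun w => hB_self P e lm hhom hpe' hroots' w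
  have hs : ∀ v w, hBl P e v w = hBl P e w v := hBl_symm P e
  have h0 : ∀ w, 0 ≤ hBl P e w w := by intro w; rw [hself]; positivity
  have hdf : ∀ w, hBl P e w w = 0 → w = 0 := by
    intro w hw
    rw [hself, Finset.sum_eq_zero_iff_of_nonneg (fun i _ => sq_nonneg _)] at hw
    apply hcomplete; ext i; simpa using hw i (Finset.mem_univ i)
  have hne : ∀ i, hdP P (x - lm x i • e) e ≠ 0 := fun i => h_De_ne P e lm hhom hpe' hroots' x hsimple i
  have hL5 := h_L5 P e lm hhom hpe' hroots' hord hcomplete hiso hrange x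
  have hmono := h_mono P e lm hhom hpe' hroots' x hsimple
  have hBx := hB_x P e lm hhom hpe' hroots' x hsimple
  have hBx : ∀ v (δ : Fin d → ℝ), (∀ i, hdP P (x - lm x i • e) v = δ i * hdP P (x - lm x i • e) e) →
    hBl P e v x = ∑ i, δ i * lm x i := hBx
  have hgB : ∀ i v, hdP P (x - lm x i • e) v = hBl P e (g i) v := by
    intro i v
    rw [← (h_fderiv P (x - lm x i • e) v).2, hg, ← hself, ← hself]
    simp only [map_add, map_sub, LinearMap.add_apply, LinearMap.sub_apply, hs v (g i)]
    ring
  obtain ⟨c, hcdef⟩ : ∃ c : Fin d → Fin n → ℝ, ∀ i, c i = (hdP P (x - lm x i • e) e)⁻¹ • g i :=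
    ⟨_, fun _ => rfl⟩
  have hcB : ∀ i v, hBl P e (c i) v = hdP P (x - lm x i • e) v / hdP P (x - lm x i • e) e := by
    intro i v
    simp only [hcdef, map_smul, LinearMap.smul_apply, smul_eq_mul]
    rw [← hgB i v, inv_mul_eq_div]
  have hce : ∀ i, hBl P e (c i) e = 1 := by
    intro i; rw [hcB, div_self (hne i)]
  have hcx : ∀ i, hBl P e (c i) x = lm x i := by
    intro i
    have h1 := hdP_euler P hhom (x - lm x i • e)
    rw [hroots', Finset.prod_eq_zero (Finset.mem_univ i) (sub_self _), mul_zero, mul_zero] at h1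
    have h2 : hBl P e (c i) (x - lm x i • e) = 0 := by rw [hcB, h1, zero_div]
    rw [map_sub, map_smul, hce, smul_eq_mul] at h2
    linarith
  have hle : ∀ i, hBl P e (c i) (c i) ≤ 1 := by
    intro i
    set R := Real.sqrt (hBl P e (c i) (c i)) with hR
    have hRk : ∀ k, lm (c i) k ≤ R := by
      intro k
      apply Real.le_sqrt_of_sq_le
      rw [hself]
      exact Finset.single_le_sum (f := fun k => lm (c i) k ^ 2) (fun _ _ => sq_nonneg _) (Finset.mem_univ k)
    have hz : ∀ j, 0 ≤ lm (R • e - c i) j := by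
      intro j
      have h1 := hroots' (R • e - c i) (lm (R • e - c i) j)
      rw [Finset.prod_eq_zero (Finset.mem_univ j) (sub_self _), mul_zero] at h1
      have e1 : R • e - c i - lm (R • e - c i) j • e
          = (-1 : ℝ) • (c i - (R - lm (R • e - c i) j) • e) := by
        rw [sub_smul, neg_smul, one_smul]; abel
      rw [e1, h_smul P hhom, hroots'] at h1
      have h2 : ∏ k, (lm (c i) k - (R - lm (R • e - c i) j)) = 0 := by
        rcases mul_eq_zero.1 h1 with h | h
        · exact absurd h (by simp)
        · exact (mul_eq_zero.1 h).resolve_left hpe'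
      obtain ⟨k, -, hk⟩ := Finset.prod_eq_zero_iff.1 h2
      linarith [hRk k]
    have h3 := hmono _ hz i
    rw [← hcB, map_sub, map_smul, hce, smul_eq_mul, mul_one] at h3
    have h4 : R ^ 2 = hBl P e (c i) (c i) := Real.sq_sqrt (h0 _)
    have h5 : 0 ≤ R := Real.sqrt_nonneg _
    rw [← h4] at h3 ⊢
    nlinarith
  have hxB : ∀ v, hBl P e v x = ∑ i, hBl P e (c i) v * lm x i := by
    intro v
    apply hBx
    intro i
    rw [hcB, div_mul_cancel₀ _ (hne i)]
  obtain ⟨hxs, hlm, horth⟩ := h_linalg (hBl P e) lm hs h0 hdf x (lm x) hsimple c hxB hcx hle (by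
    intro u hu
    obtain ⟨v, h1, h2⟩ := hL5 u hu
    refine ⟨v, h1, by rw [hself, h1], ?_⟩
    intro i
    rw [hcB, h2, mul_div_cancel_right₀ _ (hne i)])
  have hyc : y = ∑ i, max (lm x i) 0 • c i := by
    rw [hy]
    apply Finset.sum_congr rfl; intro i _
    rw [(h_fderiv P (x - lm x i • e) e).2, hcdef, smul_smul, div_eq_mul_inv]
  have hyl : lm y = fun i => max (lm x i) 0 := by
    rw [hyc]
    apply hlm
    intro i j hij
    exact max_le_max_right _ (hord x hij)
  refine ⟨fun j => by rw [hyl]; exact le_max_right _ _, ?_⟩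
  intro z hz
  apply Real.sqrt_le_sqrt
  rw [← hself, ← hself]
  have hxy : x - y = ∑ i, min (lm x i) 0 • c i := by
    rw [hyc]
    refine (congrArg (fun q => q - ∑ i, max (lm x i) 0 • c i) hxs).trans ?_
    change (∑ i, lm x i • c i) - ∑ i, max (lm x i) 0 • c i = _
    rw [← Finset.sum_sub_distrib]
    apply Finset.sum_congr rfl; intro i _
    rw [← sub_smul]
    have := min_add_max (lm x i) 0
    rw [show lm x i - max (lm x i) 0 = min (lm x i) 0 by linarith]
  have hSl : ∀ v, hBl P e (x - y) v = ∑ i, min (lm x i) 0 * hBl P e (c i) v := by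
    intro v; rw [hxy]; simp [map_sum, LinearMap.sum_apply]
  have h1 : hBl P e (x - y) z ≤ 0 := by
    rw [hSl]
    apply Finset.sum_nonpos
    intro i _
    apply mul_nonpos_of_nonpos_of_nonneg (min_le_right _ _)
    rw [hcB]; exact hmono z hz i
  have h2 : hBl P e (x - y) y = 0 := by
    rw [hSl]
    apply Finset.sum_eq_zero
    intro i _
    have : hBl P e (c i) y = max (lm x i) 0 := by
      rw [hyc]; simp [horth]
    rw [this]
    rcases le_total (lm x i) 0 with h | h <;> simp [h]
  have h3 := h0 (z - y)
  have e1 : x - z = (x - y) - (z - y) := by abel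
  have e2 : ∀ a b, hBl P e (a - b) (a - b) = hBl P e a a - 2 * hBl P e a b + hBl P e b b := by
    intro a b
    simp only [map_sub, LinearMap.sub_apply, hs b a]; ring
  have e3 : hBl P e (x - y) (z - y) = hBl P e (x - y) z - hBl P e (x - y) y := map_sub _ _ _
  rw [e1, e2 (x - y) (z - y), e3]
  linarith
end
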